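/- Let f be a nonsingular quadratic form with rational coefficients in n ≥ 4 variables which is positive definite, and let b be a positive rational number. Then there exists a nonzero vector v ∈ ℚ^n with f(v) = b. -/

import Mathlib

namespace Paper

open Matrix

/-- Value at `x` of the quadratic form with Gram matrix `Q`. -/
def qeval {m : ℕ} {R : Type*} [CommRing R] (Q : Matrix (Fin m) (Fin m) R) (x : Fin m → R) : R :=
  x ⬝ᵥ (Q *ᵥ x)

/-- The polar bilinear form `B(x,y) = (f(x+y) - f(x) - f(y))/2` of the quadratic form
with Gram matrix `Q`. -/
def qpolar {m : ℕ} {K : Type*} [Field K] (Q : Matrix (Fin m) (Fin m) K) (x y : Fin m → K) : K :=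
  (qeval Q (x + y) - qeval Q x - qeval Q y) / 2

/-- A real quadratic form (given by its Gram matrix `Q`) has signature `(r,s)`:
`r + s = m` and it is linearly equivalent over `ℝ` to
`x_1^2 + ... + x_r^2 - x_{r+1}^2 - ... - x_m^2`. -/
def RealSignature {m : ℕ} (Q : Matrix (Fin m) (Fin m) ℝ) (r s : ℕ) : Prop :=
  r + s = m ∧ ∃ T : Matrix (Fin m) (Fin m) ℝ, T.det ≠ 0 ∧
    ∀ x : Fin m → ℝ, qeval Q (T *ᵥ x) = ∑ i : Fin m, (if (i : ℕ) < r then (x i)^2 else -(x i)^2)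

/-- A rational quadratic form has signature `(r,s)` if it does as a real quadratic form. -/
def HasSignature {m : ℕ} (Q : Matrix (Fin m) (Fin m) ℚ) (r s : ℕ) : Prop :=
  RealSignature (Q.map (Rat.cast : ℚ → ℝ)) r s

/-- The rational quadratic form `F` (in `n` variables) represents the rational quadratic
form `G` (in `k` variables): after a linear change of coordinates over `ℚ`,
`F(x_1,...,x_n) = G(x_1,...,x_k) + H(x_{k+1},...,x_n)` for some rational quadratic form `H`. -/
def Represents {n k : ℕ} (F : Matrix (Fin n) (Fin n) ℚ) (G : Matrix (Fin k) (Fin k) ℚ) : Prop :=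
  ∃ (m : ℕ) (hm : n = k + m) (H : Matrix (Fin m) (Fin m) ℚ) (T : Matrix (Fin n) (Fin n) ℚ),
    T.det ≠ 0 ∧ ∀ (x : Fin k → ℚ) (y : Fin m → ℚ),
      qeval F (T *ᵥ (Fin.append x y ∘ Fin.cast hm)) = qeval G x + qeval H y

/-- The group `O(f, A)` of matrices in `GL(m, A)` preserving the quadratic form `f`
(with Gram matrix `Q` over `K ⊇ A`): those `M` with `f(Mx) = f(x)` for all `x`. -/
def ortho {m : ℕ} (A : Type*) [CommRing A] {K : Type*} [Field K] [Algebra A K]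
    (Q : Matrix (Fin m) (Fin m) K) : Subgroup (GL (Fin m) A) where
  carrier := { M | ∀ x : Fin m → K,
      qeval Q (((M : Matrix (Fin m) (Fin m) A).map (algebraMap A K)) *ᵥ x) = qeval Q x }
  one_mem' := by
    intro x
    have h1 : ((1 : GL (Fin m) A) : Matrix (Fin m) (Fin m) A).map (algebraMap A K) = 1 := by
      simp [Matrix.map_one]
    rw [h1, Matrix.one_mulVec]
  mul_mem' := by
    intro a b ha hb x
    have h : ((a * b : GL (Fin m) A) : Matrix (Fin m) (Fin m) A).map (algebraMap A K)
        = ((a : Matrix (Fin m) (Fin m) A).map (algebraMap A K)) *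
          ((b : Matrix (Fin m) (Fin m) A).map (algebraMap A K)) := by
      rw [Units.val_mul, Matrix.map_mul]
    rw [h, ← Matrix.mulVec_mulVec, ha, hb]
  inv_mem' := by
    intro a ha x
    set M := ((a : Matrix (Fin m) (Fin m) A).map (algebraMap A K)) with hM
    set N := (((a⁻¹ : GL (Fin m) A) : Matrix (Fin m) (Fin m) A).map (algebraMap A K)) with hN
    have hMN : M * N = 1 := by
      rw [hM, hN, ← Matrix.map_mul]
      have : (a : Matrix (Fin m) (Fin m) A) * ((a⁻¹ : GL (Fin m) A) : Matrix (Fin m) (Fin m) A)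
          = 1 := a.mul_inv
      rw [this]
      simp [Matrix.map_one]
    have ha' : ∀ y : Fin m → K, qeval Q (M *ᵥ y) = qeval Q y := ha
    calc qeval Q (N *ᵥ x) = qeval Q (M *ᵥ (N *ᵥ x)) := (ha' (N *ᵥ x)).symm
      _ = qeval Q ((M * N) *ᵥ x) := by rw [Matrix.mulVec_mulVec]
      _ = qeval Q x := by rw [hMN, Matrix.one_mulVec]

/-- `O(f, ℤ)` for a rational quadratic form `f` with Gram matrix `Q`. -/
abbrev OZ {m : ℕ} (Q : Matrix (Fin m) (Fin m) ℚ) : Subgroup (GL (Fin m) ℤ) := ortho ℤ Q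

/-- A group is finitely presented: it is a quotient of a finitely generated free group by
the normal closure of a finite set of relators. -/
def IsFinitelyPresented (G : Type*) [Group G] : Prop :=
  ∃ (n : ℕ) (rels : Set (FreeGroup (Fin n))), rels.Finite ∧ Nonempty (PresentedGroup rels ≃* G)

/-- A group is coherent if each of its finitely generated subgroups is finitely presented. -/
def IsCoherent (G : Type*) [Group G] : Prop :=
  ∀ H : Subgroup G, Group.FG H → IsFinitelyPresented H

/-- Two groups are abstractly commensurable if they contain isomorphic
subgroups of finite index. -/
def AbstractlyCommensurable (G H : Type*) [Group G] [Group H] : Prop :=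
  ∃ (G' : Subgroup G) (H' : Subgroup H), G'.FiniteIndex ∧ H'.FiniteIndex ∧ Nonempty (G' ≃* H')

/-- The form `q₃ = -x₀² + x₁² + x₂² + x₃²`. -/
def q3 : Matrix (Fin 4) (Fin 4) ℚ := Matrix.diagonal ![-1, 1, 1, 1]

end Paper

namespace Paper


def I3 (K : Type) [Field K] (a b c : K) : Prop :=
  ∃ x y z : K, (x ≠ 0 ∨ y ≠ 0 ∨ z ≠ 0) ∧ a * x ^ 2 + b * y ^ 2 + c * z ^ 2 = 0

theorem I3.scale {K : Type} [Field K] {a b c a' b' c' : K} (α β γ κ : K) (hα : α ≠ 0)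
    (hβ : β ≠ 0) (hγ : γ ≠ 0) (h1 : κ * a = a' * α ^ 2) (h2 : κ * b = b' * β ^ 2)
    (h3 : κ * c = c' * γ ^ 2) (h : I3 K a b c) : I3 K a' b' c' := by
  obtain ⟨x, y, z, hne, h⟩ := h
  refine ⟨α * x, β * y, γ * z, by simpa [hα, hβ, hγ] using hne, ?_⟩
  linear_combination κ * h - x ^ 2 * h1 - y ^ 2 * h2 - z ^ 2 * h3

theorem I3.swap12 {K : Type} [Field K] {a b c : K} (h : I3 K a b c) : I3 K b a c := by
  obtain ⟨x, y, z, hne, h⟩ := h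
  exact ⟨y, x, z, by tauto, by linear_combination h⟩

theorem I3.swap23 {K : Type} [Field K] {a b c : K} (h : I3 K a b c) : I3 K a c b := by
  obtain ⟨x, y, z, hne, h⟩ := h
  exact ⟨x, z, y, by tauto, by linear_combination h⟩

theorem sq_hensel {p : ℕ} [Fact p.Prime] (a u : ℤ_[p]) (h : ‖a ^ 2 - u‖ < ‖2 * a‖ ^ 2) :
    ∃ c : ℤ_[p], c ^ 2 = u := by
  have := hensels_lemma (p := p) (F := (Polynomial.X ^ 2 - Polynomial.C u : Polynomial ℤ_[p]))
    (a := a) (by simpa [one_add_one_eq_two] using h)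
  obtain ⟨z, hz, -⟩ := this
  refine ⟨z, ?_⟩
  simp at hz
  linear_combination hz

theorem lift_int {p : ℕ} [Fact p.Prime] (x : ℚ_[p]) (h : ‖x‖ ≤ 1) :
    ∃ u : ℤ_[p], (u : ℚ_[p]) = x := ⟨⟨x, h⟩, rfl⟩

theorem close_sq {p : ℕ} [Fact p.Prime] (s t : ℚ_[p]) (ht : t ≠ 0)
    (h : ‖s - t‖ < ‖t‖ * ‖(4 : ℚ_[p])‖) : ∃ c : ℚ_[p], c ≠ 0 ∧ s = t * c ^ 2 := by
  have htn : 0 < ‖t‖ := norm_pos_iff.2 ht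
  have h4 : ‖(4 : ℚ_[p])‖ ≤ 1 := by
    have := Padic.norm_int_le_one (p := p) 4
    simpa using this
  have hu : ‖s / t - 1‖ < ‖(4 : ℚ_[p])‖ := by
    have e : s / t - 1 = (s - t) / t := by field_simp
    rw [e, norm_div, div_lt_iff₀ htn]
    linarith
  have hu1 : ‖s / t‖ ≤ 1 := by
    have e : s / t = (s / t - 1) + 1 := by ring
    rw [e]
    refine (Padic.nonarchimedean _ _).trans ?_
    simp only [norm_one, max_le_iff, le_refl, and_true]
    linarith
  obtain ⟨w, hw⟩ := lift_int (s / t) hu1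
  obtain ⟨c, hc⟩ := sq_hensel (p := p) 1 w (by
    rw [norm_sub_rev, PadicInt.norm_def]
    have e4 : ‖(2 * 1 : ℤ_[p])‖ ^ 2 = ‖(4 : ℚ_[p])‖ := by
      have e : (4 : ℚ_[p]) = 2 ^ 2 := by norm_num
      rw [e, norm_pow, mul_one, PadicInt.norm_def]
      rfl
    rw [e4]
    push_cast
    rw [hw]
    simpa using hu)
  have hc' : (c : ℚ_[p]) ^ 2 = s / t := by
    rw [← hw]
    have := congrArg (fun x : ℤ_[p] => (x : ℚ_[p])) hc
    simpa using this
  refine ⟨c, ?_, ?_⟩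
  · intro h0
    rw [h0] at hc'
    have : s / t = 0 := by rw [← hc']; simp
    rw [this] at hu
    simp at hu
    linarith
  · rw [hc']; field_simp

theorem primitive3 {p : ℕ} [Fact p.Prime] (a b c : ℤ) (h : I3 ℚ_[p] a b c) :
    ∃ x y z : ℤ_[p], (‖x‖ = 1 ∨ ‖y‖ = 1 ∨ ‖z‖ = 1) ∧
      (a : ℤ_[p]) * x ^ 2 + b * y ^ 2 + c * z ^ 2 = 0 := by
  obtain ⟨x, y, z, hne, h⟩ := h
  have hm : ∃ e : ℚ_[p], e ≠ 0 ∧ ‖x‖ ≤ ‖e‖ ∧ ‖y‖ ≤ ‖e‖ ∧ ‖z‖ ≤ ‖e‖ ∧ (e = x ∨ e = y ∨ e = z) := by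
    have : ∃ e : ℚ_[p], ‖x‖ ≤ ‖e‖ ∧ ‖y‖ ≤ ‖e‖ ∧ ‖z‖ ≤ ‖e‖ ∧ (e = x ∨ e = y ∨ e = z) := by
      rcases le_total ‖x‖ ‖y‖ with h1 | h1
      · rcases le_total ‖y‖ ‖z‖ with h2 | h2
        · exact ⟨z, h1.trans h2, h2, le_rfl, by simp⟩
        · exact ⟨y, h1, le_rfl, h2, by simp⟩
      · rcases le_total ‖x‖ ‖z‖ with h2 | h2
        · exact ⟨z, h2, h1.trans h2, le_rfl, by simp⟩
        · exact ⟨x, le_rfl, h1, h2, by simp⟩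
    obtain ⟨e, h1, h2, h3, h4⟩ := this
    refine ⟨e, ?_, h1, h2, h3, h4⟩
    rintro rfl
    simp at h1 h2 h3
    tauto
  obtain ⟨e, he, h1, h2, h3, h4⟩ := hm
  have hen : 0 < ‖e‖ := norm_pos_iff.2 he
  have b1 : ‖x / e‖ ≤ 1 := by rw [norm_div]; exact (div_le_one hen).2 h1
  have b2 : ‖y / e‖ ≤ 1 := by rw [norm_div]; exact (div_le_one hen).2 h2
  have b3 : ‖z / e‖ ≤ 1 := by rw [norm_div]; exact (div_le_one hen).2 h3
  obtain ⟨x', hx'⟩ := lift_int _ b1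
  obtain ⟨y', hy'⟩ := lift_int _ b2
  obtain ⟨z', hz'⟩ := lift_int _ b3
  refine ⟨x', y', z', ?_, ?_⟩
  · simp only [PadicInt.norm_def, hx', hy', hz']
    rcases h4 with rfl | rfl | rfl
    · left; rw [div_self he]; simp
    · right; left; rw [div_self he]; simp
    · right; right; rw [div_self he]; simp
  · apply Subtype.coe_injective
    push_cast
    rw [hx', hy', hz']
    field_simp
    linear_combination h

theorem padic_int_dvd {p : ℕ} [Fact p.Prime] (k : ℕ) (a : ℤ) :
    ((p : ℤ_[p]) ^ k ∣ (a : ℤ_[p])) ↔ ((p : ℤ) ^ k ∣ a) := by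
  rw [← PadicInt.norm_int_le_pow_iff_dvd, PadicInt.norm_le_pow_iff_mem_span_pow,
    Ideal.mem_span_singleton]

theorem toZMod_zero {p : ℕ} [Fact p.Prime] (x : ℤ_[p]) :
    PadicInt.toZMod x = 0 ↔ ‖x‖ < 1 := by
  rw [← RingHom.mem_ker, PadicInt.ker_toZMod, PadicInt.maximalIdeal_eq_span_p,
    Ideal.mem_span_singleton, PadicInt.norm_lt_one_iff_dvd]

theorem toZMod_ne {p : ℕ} [Fact p.Prime] (x : ℤ_[p]) :
    PadicInt.toZMod x ≠ 0 ↔ ‖x‖ = 1 := by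
  rw [Ne, toZMod_zero, not_lt]
  exact ⟨fun h => le_antisymm (PadicInt.norm_le_one x) h, fun h => h.ge⟩

theorem resid {p : ℕ} [Fact p.Prime] (a b c : ℤ) (ha : (p : ℤ) ∣ a) (ha2 : ¬ (p : ℤ) ^ 2 ∣ a)
    (hb : ¬ (p : ℤ) ∣ b) (hc : ¬ (p : ℤ) ∣ c) (h : I3 ℚ_[p] a b c) :
    IsSquare (-((b : ZMod p) * (c : ZMod p))) := by
  obtain ⟨x, y, z, hne, h⟩ := primitive3 a b c h
  have hb' : (b : ZMod p) ≠ 0 := by rwa [Ne, ZMod.intCast_zmod_eq_zero_iff_dvd]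
  have hc' : (c : ZMod p) ≠ 0 := by rwa [Ne, ZMod.intCast_zmod_eq_zero_iff_dvd]
  have ha' : (a : ZMod p) = 0 := by rwa [ZMod.intCast_zmod_eq_zero_iff_dvd]
  have hz := congrArg (PadicInt.toZMod (p := p)) h
  simp only [map_add, map_mul, map_pow, map_intCast, ha', zero_mul, zero_add, map_zero] at hz
  by_cases hy : PadicInt.toZMod y = 0
  · have hzz : PadicInt.toZMod z = 0 := by
      rw [hy] at hz
      simpa [hc'] using hz
    exfalso
    have hy1 := (toZMod_zero y).1 hy
    have hz1 := (toZMod_zero z).1 hzz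
    have hx : ‖x‖ = 1 := by
      rcases hne with h | h | h
      · exact h
      · linarith
      · linarith
    rw [PadicInt.norm_lt_one_iff_dvd] at hy1 hz1
    obtain ⟨y', rfl⟩ := hy1
    obtain ⟨z', rfl⟩ := hz1
    apply ha2
    rw [← padic_int_dvd]
    have hxu : IsUnit (x ^ 2) := (PadicInt.isUnit_iff.2 hx).pow 2
    rw [← hxu.dvd_mul_right]
    exact ⟨-(b * y' ^ 2 + c * z' ^ 2), by linear_combination h⟩
  · refine ⟨c * PadicInt.toZMod z / PadicInt.toZMod y, ?_⟩
    field_simp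
    linear_combination -hz

theorem lift1 {p : ℕ} [Fact p.Prime] (hp : p ≠ 2) (a b c x y : ℤ_[p]) (ha : ‖a‖ = 1)
    (hx : ‖x‖ = 1) (h : PadicInt.toZMod (a * x ^ 2 + b * y ^ 2 + c) = 0) :
    I3 ℚ_[p] a b c := by
  obtain ⟨a', ha'⟩ := (PadicInt.isUnit_iff.2 ha).exists_right_inv
  have h2 : ‖(2 : ℤ_[p])‖ = 1 := by
    rw [← toZMod_ne, map_ofNat]
    exact Ring.two_ne_zero (by rwa [ZMod.ringChar_zmod_n p])
  obtain ⟨u, hu⟩ := sq_hensel x (-(c + b * y ^ 2) * a') (by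
    rw [norm_mul, h2, hx]
    have e : x ^ 2 - -(c + b * y ^ 2) * a' = (a * x ^ 2 + b * y ^ 2 + c) * a' := by
      linear_combination -(x ^ 2) * ha'
    rw [e, norm_mul]
    have := (toZMod_zero _).1 h
    have h' := PadicInt.norm_le_one a'
    nlinarith [norm_nonneg (a * x ^ 2 + b * y ^ 2 + c)])
  refine ⟨u, y, 1, by simp, ?_⟩
  have : a * u ^ 2 + b * y ^ 2 + c * 1 ^ 2 = 0 := by
    rw [hu]
    linear_combination -(c + b * y ^ 2) * ha'
  exact_mod_cast congrArg (fun x : ℤ_[p] => (x : ℚ_[p])) this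

theorem unit3 {p : ℕ} [Fact p.Prime] (hp : p ≠ 2) (a b c : ℤ_[p]) (ha : ‖a‖ = 1)
    (hb : ‖b‖ = 1) (hc : ‖c‖ = 1) : I3 ℚ_[p] a b c := by
  have ha' := (toZMod_ne a).2 ha
  have hb' := (toZMod_ne b).2 hb
  have hc' := (toZMod_ne c).2 hc
  obtain ⟨x, y, hxy⟩ := FiniteField.exists_root_sum_quadratic (R := ZMod p)
    (f := Polynomial.C (PadicInt.toZMod a) * Polynomial.X ^ 2 + Polynomial.C (PadicInt.toZMod c))
    (g := Polynomial.C (PadicInt.toZMod b) * Polynomial.X ^ 2)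
    (by compute_degree <;> simp_all) (by compute_degree <;> simp_all)
    (by rw [ZMod.card]; exact (Nat.Prime.mod_two_eq_one_iff_ne_two (Fact.out : p.Prime)).2 hp)
  simp at hxy
  obtain ⟨x, rfl⟩ := ZMod.ringHom_surjective (PadicInt.toZMod (p := p)) x
  obtain ⟨y, rfl⟩ := ZMod.ringHom_surjective (PadicInt.toZMod (p := p)) y
  by_cases hx : PadicInt.toZMod x = 0
  · have hy : PadicInt.toZMod y ≠ 0 := by
      intro hy
      rw [hx, hy] at hxy
      simp at hxy
      exact hc' hxy
    apply I3.swap12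
    apply lift1 hp b a c y x hb ((toZMod_ne y).1 hy)
    simp only [map_add, map_mul, map_pow]
    linear_combination hxy
  · apply lift1 hp a b c x y ha ((toZMod_ne x).1 hx)
    simp only [map_add, map_mul, map_pow]
    linear_combination hxy



set_option maxHeartbeats 2000000 in
theorem legendre_core (a b c : ℕ) (ha : 0 < a) (hb : 0 < b) (hc : 0 < c)
    (hab : Nat.Coprime a b) (hac : Nat.Coprime a c) (hbc : Nat.Coprime b c)
    (h1 : IsSquare ((b * c : ℕ) : ZMod a)) (h2 : IsSquare ((c * a : ℕ) : ZMod b))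
    (h3 : IsSquare (-((a * b : ℕ) : ZMod c))) :
    ∃ x y z : ℤ, (x ≠ 0 ∨ y ≠ 0 ∨ z ≠ 0) ∧ a * x ^ 2 + b * y ^ 2 = c * z ^ 2 := by
  obtain ⟨r1, hr1⟩ := h1
  obtain ⟨r2, hr2⟩ := h2
  obtain ⟨r3, hr3⟩ := h3
  have : NeZero a := ⟨ha.ne'⟩
  have : NeZero b := ⟨hb.ne'⟩
  have : NeZero c := ⟨hc.ne'⟩
  have key : ∀ n : ℕ, 0 < n → ∃ X : ℕ, 0 < X ∧ n ≤ X ^ 2 ∧ ∀ x : ℕ, x < X → x ^ 2 < n := by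
    intro n hn
    refine ⟨Nat.sqrt (n - 1) + 1, by omega, ?_, ?_⟩
    · have := Nat.lt_succ_sqrt' (n - 1)
      simp only [Nat.succ_eq_add_one] at this
      omega
    · intro x hx
      have : x ≤ Nat.sqrt (n - 1) := by omega
      rw [Nat.le_sqrt'] at this
      omega
  obtain ⟨X, hX0, hX, hX'⟩ := key (b * c) (by positivity)
  obtain ⟨Y, hY0, hY, hY'⟩ := key (c * a) (by positivity)
  obtain ⟨Z, hZ0, hZ, hZ'⟩ := key (a * b) (by positivity)
  by_cases hXYZ : X ^ 2 = b * c ∧ Y ^ 2 = c * a ∧ Z ^ 2 = a * b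
  · refine ⟨X, 0, Z, Or.inl (by exact_mod_cast hX0.ne'), ?_⟩
    have e1 : (X : ℤ) ^ 2 = b * c := by exact_mod_cast hXYZ.1
    have e3 : (Z : ℤ) ^ 2 = a * b := by exact_mod_cast hXYZ.2.2
    rw [e1, e3]; ring
  have hlt : a * b * c < X * Y * Z := by
    have h : (a * b * c) ^ 2 < (X * Y * Z) ^ 2 := by
      have e : (a * b * c) ^ 2 = (b * c) * (c * a) * (a * b) := by ring
      rw [e, mul_pow, mul_pow]
      have hA : 0 < b * c := by positivity
      have hB : 0 < c * a := by positivity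
      have hC : 0 < a * b := by positivity
      by_cases k1 : b * c < X ^ 2
      · have : (b * c) * (c * a) < X ^ 2 * Y ^ 2 := Nat.mul_lt_mul_of_lt_of_le k1 hY (by positivity)
        exact Nat.mul_lt_mul_of_lt_of_le this hZ (by positivity)
      by_cases k2 : c * a < Y ^ 2
      · have : (b * c) * (c * a) < X ^ 2 * Y ^ 2 := Nat.mul_lt_mul_of_le_of_lt hX k2 (by positivity)
        exact Nat.mul_lt_mul_of_lt_of_le this hZ (by positivity)
      by_cases k3 : a * b < Z ^ 2
      · exact Nat.mul_lt_mul_of_le_of_lt (Nat.mul_le_mul hX hY) k3 (by positivity)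
      exact absurd ⟨by omega, by omega, by omega⟩ hXYZ
    exact lt_of_pow_lt_pow_left₀ 2 (by positivity) h
  let f : ℕ × ℕ × ℕ → ZMod a × ZMod b × ZMod c := fun v =>
    (b * v.2.1 - r1 * v.2.2, c * v.2.2 - r2 * v.1, a * v.1 - r3 * v.2.1)
  obtain ⟨⟨x1, y1, z1⟩, hv1, ⟨x2, y2, z2⟩, hv2, hne, hf⟩ :=
    Finset.exists_ne_map_eq_of_card_lt_of_maps_to
      (s := Finset.range X ×ˢ Finset.range Y ×ˢ Finset.range Z) (t := Finset.univ) (f := f)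
      (by simp [ZMod.card]; nlinarith [hlt]) (by intro _ _; simp)
  simp only [f, Prod.mk.injEq] at hf
  obtain ⟨f1, f2, f3⟩ := hf
  simp only [Finset.mem_product, Finset.mem_range] at hv1 hv2
  have small : ∀ (N W : ℕ) (_ : ∀ x : ℕ, x < W → x ^ 2 < N) (u v : ℕ), u < W → v < W →
      ((u : ℤ) - v) ^ 2 < N := by
    intro N W hW u v hu hv
    rcases le_total u v with h | h
    · have := hW (v - u) (by omega)
      zify [h] at this
      nlinarith
    · have := hW (u - v) (by omega)
      zify [h] at this
      nlinarith
  have sx := small _ _ hX' x1 x2 hv1.1 hv2.1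
  have sy := small _ _ hY' y1 y2 hv1.2.1 hv2.2.1
  have sz := small _ _ hZ' z1 z2 hv1.2.2 hv2.2.2
  have hnz : ((x1 : ℤ) - x2) ≠ 0 ∨ ((y1 : ℤ) - y2) ≠ 0 ∨ ((z1 : ℤ) - z2) ≠ 0 := by
    by_contra hcon
    push Not at hcon
    apply hne
    simp only [Prod.mk.injEq]
    omega
  have g1 : ((b : ZMod a)) * (((y1 : ℤ) - y2 : ℤ) : ZMod a) = r1 * (((z1 : ℤ) - z2 : ℤ) : ZMod a) := by
    push_cast; linear_combination f1
  have g2 : ((c : ZMod b)) * (((z1 : ℤ) - z2 : ℤ) : ZMod b) = r2 * (((x1 : ℤ) - x2 : ℤ) : ZMod b) := by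
    push_cast; linear_combination f2
  have g3 : ((a : ZMod c)) * (((x1 : ℤ) - x2 : ℤ) : ZMod c) = r3 * (((y1 : ℤ) - y2 : ℤ) : ZMod c) := by
    push_cast; linear_combination f3
  generalize ((x1 : ℤ) - x2) = x at *
  generalize ((y1 : ℤ) - y2) = y at *
  generalize ((z1 : ℤ) - z2) = z at *
  push_cast at hr1 hr2 hr3
  have d1 : (a : ℤ) ∣ a * x ^ 2 + b * y ^ 2 - c * z ^ 2 := by
    rw [← ZMod.intCast_zmod_eq_zero_iff_dvd]
    have hu : IsUnit (b : ZMod a) := (ZMod.isUnit_iff_coprime b a).2 hab.symm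
    apply hu.mul_left_cancel
    push_cast
    rw [ZMod.natCast_self]
    linear_combination (b * y + r1 * z) * g1 - z ^ 2 * hr1
  have d2 : (b : ℤ) ∣ a * x ^ 2 + b * y ^ 2 - c * z ^ 2 := by
    rw [← ZMod.intCast_zmod_eq_zero_iff_dvd]
    have hu : IsUnit (c : ZMod b) := (ZMod.isUnit_iff_coprime c b).2 hbc.symm
    apply hu.mul_left_cancel
    push_cast
    rw [ZMod.natCast_self]
    linear_combination -(c * z + r2 * x) * g2 + x ^ 2 * hr2
  have d3 : (c : ℤ) ∣ a * x ^ 2 + b * y ^ 2 - c * z ^ 2 := by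
    rw [← ZMod.intCast_zmod_eq_zero_iff_dvd]
    have hu : IsUnit (a : ZMod c) := (ZMod.isUnit_iff_coprime a c).2 hac
    apply hu.mul_left_cancel
    push_cast
    rw [ZMod.natCast_self]
    linear_combination (a * x + r3 * y) * g3 - y ^ 2 * hr3
  have dd : ((a : ℤ) * b * c) ∣ a * x ^ 2 + b * y ^ 2 - c * z ^ 2 := by
    apply IsCoprime.mul_dvd _ (IsCoprime.mul_dvd (Nat.isCoprime_iff_coprime.2 hab) d1 d2) d3
    exact IsCoprime.mul_left (Nat.isCoprime_iff_coprime.2 hac) (Nat.isCoprime_iff_coprime.2 hbc)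
  obtain ⟨k, hk⟩ := dd
  push_cast at sx sy sz
  have ha' : (0 : ℤ) < a := by exact_mod_cast ha
  have hb' : (0 : ℤ) < b := by exact_mod_cast hb
  have hc' : (0 : ℤ) < c := by exact_mod_cast hc
  have hP : (0 : ℤ) < (a : ℤ) * b * c := by positivity
  have t1 : (a : ℤ) * x ^ 2 < a * b * c := by nlinarith
  have t2 : (b : ℤ) * y ^ 2 < a * b * c := by nlinarith
  have t3 : (c : ℤ) * z ^ 2 < a * b * c := by nlinarith
  have t1' : 0 ≤ (a : ℤ) * x ^ 2 := by positivity
  have t2' : 0 ≤ (b : ℤ) * y ^ 2 := by positivity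
  have t3' : 0 ≤ (c : ℤ) * z ^ 2 := by positivity
  have k1 : -1 < k := by
    by_contra hcon
    have : k ≤ -1 := by omega
    linarith [mul_le_mul_of_nonneg_left this hP.le]
  have k2 : k < 2 := by
    by_contra hcon
    have : 2 ≤ k := by omega
    linarith [mul_le_mul_of_nonneg_left this hP.le]
  have : k = 0 ∨ k = 1 := by omega
  rcases this with rfl | rfl
  · exact ⟨x, y, z, hnz, by linarith⟩
  · refine ⟨x * z + b * y, y * z - a * x, z ^ 2 + a * b, Or.inr (Or.inr ?_), ?_⟩
    · have : 0 < z ^ 2 + (a : ℤ) * b := by positivity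
      exact this.ne'
    · linear_combination (z ^ 2 + (a : ℤ) * b) * hk


theorem I3.scale_iff {K : Type} [Field K] {a b c a' b' c' : K} (α β γ κ : K) (hα : α ≠ 0)
    (hβ : β ≠ 0) (hγ : γ ≠ 0) (hκ : κ ≠ 0) (h1 : κ * a = a' * α ^ 2) (h2 : κ * b = b' * β ^ 2)
    (h3 : κ * c = c' * γ ^ 2) : I3 K a b c ↔ I3 K a' b' c' := by
  refine ⟨I3.scale α β γ κ hα hβ hγ h1 h2 h3,
    I3.scale α⁻¹ β⁻¹ γ⁻¹ κ⁻¹ (inv_ne_zero hα) (inv_ne_zero hβ) (inv_ne_zero hγ) ?_ ?_ ?_⟩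
  · field_simp; linear_combination -h1
  · field_simp; linear_combination -h2
  · field_simp; linear_combination -h3

theorem sqfree_isSquare (k : ℤ) (n : ℕ) (hn : Squarefree n)
    (h : ∀ p : ℕ, p.Prime → p ∣ n → IsSquare (k : ZMod p)) : IsSquare (k : ZMod n) := by
  induction n using induction_on_primes with
  | zero => exact absurd hn not_squarefree_zero
  | one => exact ⟨0, Subsingleton.elim _ _⟩
  | prime_mul p a hp ih =>
    have hcop : Nat.Coprime p a := Nat.coprime_of_squarefree_mul hn
    obtain ⟨r, hr⟩ := ih (hn.squarefree_of_dvd (Dvd.intro_left p rfl))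
      (fun q hq hqa => h q hq (hqa.mul_left p))
    obtain ⟨s, hs⟩ := h p hp (Dvd.intro a rfl)
    refine ⟨(ZMod.chineseRemainder hcop).symm (s, r), ?_⟩
    apply (ZMod.chineseRemainder hcop).injective
    rw [map_mul, RingEquiv.apply_symm_apply, map_intCast]
    exact Prod.ext hs hr

theorem not_dvd_of_coprime {p a b : ℕ} (hp : p.Prime) (h : Nat.Coprime a b) (ha : p ∣ a) :
    ¬ (p : ℤ) ∣ (b : ℤ) := by
  intro hb
  exact Nat.not_coprime_of_dvd_of_dvd hp.one_lt ha (Int.natCast_dvd_natCast.1 hb) h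

theorem not_sq_dvd {p a : ℕ} (hp : p.Prime) (h : Squarefree a) : ¬ (p : ℤ) ^ 2 ∣ (a : ℤ) := by
  intro hb
  have : p * p ∣ a := by rw [← sq]; exact_mod_cast hb
  exact hp.one_lt.ne' (Nat.isUnit_iff.1 (h p this))

theorem legendre (N : ℕ) : ∀ a b c : ℕ, 0 < a → 0 < b → 0 < c → a * b * c = N →
    (∀ (p : ℕ) [Fact p.Prime], p ≠ 2 → I3 ℚ_[p] a b (-c)) → I3 ℚ a b (-c) := by
  induction N using Nat.strong_induction_on with
  | _ N ih =>
  intro a b c ha hb hc hN h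
  have step : ∀ a' b' c' α β γ κ : ℕ, 0 < a' → 0 < b' → 0 < c' → 0 < α → 0 < β → 0 < γ → 0 < κ →
      κ * a = a' * α ^ 2 → κ * b = b' * β ^ 2 → κ * c = c' * γ ^ 2 → a' * b' * c' < a * b * c →
      I3 ℚ a b (-c) := by
    intro a' b' c' α β γ κ ha' hb' hc' hα hβ hγ hκ h1 h2 h3 hlt
    have sc : ∀ (K : Type) [Field K] [CharZero K], I3 K a b (-c) ↔ I3 K a' b' (-c') := by
      intro K _ _
      have n0 : ∀ n : ℕ, 0 < n → (n : K) ≠ 0 := fun n hn => Nat.cast_ne_zero.2 hn.ne'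
      apply I3.scale_iff (α : K) β γ κ (n0 _ hα) (n0 _ hβ) (n0 _ hγ) (n0 _ hκ)
      · exact_mod_cast congrArg (Nat.cast : ℕ → K) h1
      · exact_mod_cast congrArg (Nat.cast : ℕ → K) h2
      · have : (κ : K) * c = c' * γ ^ 2 := by exact_mod_cast congrArg (Nat.cast : ℕ → K) h3
        linear_combination -this
    rw [sc]
    exact ih _ (hN ▸ hlt) a' b' c' ha' hb' hc' rfl (fun p _ hp => (sc _).1 (h p hp))
  have nsq : ∀ n : ℕ, 0 < n → ¬ Squarefree n → ∃ d m, 1 < d ∧ 0 < m ∧ n = m * d ^ 2 := by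
    intro n hn hs
    simp only [Squarefree, not_forall] at hs
    obtain ⟨d, ⟨m, hm⟩, hd⟩ := hs
    have hd0 : d ≠ 0 := by rintro rfl; simp at hm; omega
    have hm0 : m ≠ 0 := by rintro rfl; simp at hm; omega
    have hd1 : d ≠ 1 := by simpa using hd
    exact ⟨d, m, by omega, by omega, by rw [hm]; ring⟩
  by_cases sa : Squarefree a
  swap
  · obtain ⟨d, m, hd, hm, rfl⟩ := nsq a ha sa
    refine step m b c d 1 1 1 hm hb hc (by omega) one_pos one_pos one_pos (by ring) (by ring) (by ring) ?_
    have : 1 < d ^ 2 := Nat.one_lt_pow (by norm_num) hd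
    have h3 : 0 < m * b * c := by positivity
    nlinarith
  by_cases sb : Squarefree b
  swap
  · obtain ⟨d, m, hd, hm, rfl⟩ := nsq b hb sb
    refine step a m c 1 d 1 1 ha hm hc one_pos (by omega) one_pos one_pos (by ring) (by ring) (by ring) ?_
    have : 1 < d ^ 2 := Nat.one_lt_pow (by norm_num) hd
    have h3 : 0 < a * m * c := by positivity
    nlinarith
  by_cases scc : Squarefree c
  swap
  · obtain ⟨d, m, hd, hm, rfl⟩ := nsq c hc scc
    refine step a b m 1 1 d 1 ha hb hm one_pos one_pos (by omega) one_pos (by ring) (by ring) (by ring) ?_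
    have : 1 < d ^ 2 := Nat.one_lt_pow (by norm_num) hd
    have h3 : 0 < a * b * m := by positivity
    nlinarith
  by_cases cab : Nat.Coprime a b
  swap
  · obtain ⟨p, hp, ⟨a', rfl⟩, ⟨b', rfl⟩⟩ := Nat.Prime.not_coprime_iff_dvd.1 cab
    have ha' : 0 < a' := Nat.pos_of_mul_pos_left ha
    have hb' : 0 < b' := Nat.pos_of_mul_pos_left hb
    refine step a' b' (p * c) p p 1 p ha' hb' (Nat.mul_pos hp.pos hc) hp.pos hp.pos one_pos hp.pos
      (by ring) (by ring) (by ring) ?_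
    have h3 : 0 < p * (a' * b' * c) := Nat.mul_pos hp.pos (by positivity)
    nlinarith [hp.one_lt]
  by_cases cac : Nat.Coprime a c
  swap
  · obtain ⟨p, hp, ⟨a', rfl⟩, ⟨c', rfl⟩⟩ := Nat.Prime.not_coprime_iff_dvd.1 cac
    have ha' : 0 < a' := Nat.pos_of_mul_pos_left ha
    have hc' : 0 < c' := Nat.pos_of_mul_pos_left hc
    refine step a' (p * b) c' p 1 p p ha' (Nat.mul_pos hp.pos hb) hc' hp.pos one_pos hp.pos hp.pos
      (by ring) (by ring) (by ring) ?_
    have h3 : 0 < p * (a' * b * c') := Nat.mul_pos hp.pos (by positivity)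
    nlinarith [hp.one_lt]
  by_cases cbc : Nat.Coprime b c
  swap
  · obtain ⟨p, hp, ⟨b', rfl⟩, ⟨c', rfl⟩⟩ := Nat.Prime.not_coprime_iff_dvd.1 cbc
    have hb' : 0 < b' := Nat.pos_of_mul_pos_left hb
    have hc' : 0 < c' := Nat.pos_of_mul_pos_left hc
    refine step (p * a) b' c' 1 p p p (Nat.mul_pos hp.pos ha) hb' hc' one_pos hp.pos hp.pos hp.pos
      (by ring) (by ring) (by ring) ?_
    have h3 : 0 < p * (a * b' * c') := Nat.mul_pos hp.pos (by positivity)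
    nlinarith [hp.one_lt]
  have two : ∀ k : ZMod 2, IsSquare k := by decide
  have h1 : IsSquare (((b * c : ℕ) : ℤ) : ZMod a) := by
    apply sqfree_isSquare _ _ sa
    intro p hp hpa
    have : Fact p.Prime := ⟨hp⟩
    by_cases hp2 : p = 2
    · subst hp2; exact two _
    have := resid (p := p) a b (-c) (by exact_mod_cast hpa) (not_sq_dvd hp sa)
      (not_dvd_of_coprime hp cab hpa) (by rw [dvd_neg]; exact not_dvd_of_coprime hp cac hpa)
      (by exact_mod_cast h p hp2)
    simpa using this
  have h2 : IsSquare (((c * a : ℕ) : ℤ) : ZMod b) := by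
    apply sqfree_isSquare _ _ sb
    intro p hp hpa
    have : Fact p.Prime := ⟨hp⟩
    by_cases hp2 : p = 2
    · subst hp2; exact two _
    have := resid (p := p) b (-c) a (by exact_mod_cast hpa) (not_sq_dvd hp sb)
      (by rw [dvd_neg]; exact not_dvd_of_coprime hp cbc hpa) (not_dvd_of_coprime hp cab.symm hpa)
      (by exact_mod_cast (h p hp2).swap12.swap23)
    simpa using this
  have h3 : IsSquare ((-((a * b : ℕ) : ℤ) : ℤ) : ZMod c) := by
    apply sqfree_isSquare _ _ scc
    intro p hp hpa
    have : Fact p.Prime := ⟨hp⟩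
    by_cases hp2 : p = 2
    · subst hp2; exact two _
    have := resid (p := p) (-c) a b (by rw [dvd_neg]; exact_mod_cast hpa)
      (by rw [dvd_neg]; exact not_sq_dvd hp scc)
      (not_dvd_of_coprime hp cac.symm hpa) (not_dvd_of_coprime hp cbc.symm hpa)
      (by exact_mod_cast (h p hp2).swap23.swap12)
    simpa using this
  obtain ⟨x, y, z, hne, hxyz⟩ := legendre_core a b c ha hb hc cab cac cbc (by exact_mod_cast h1)
    (by exact_mod_cast h2) (by simpa using h3)
  refine ⟨x, y, z, by exact_mod_cast hne, ?_⟩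
  have : (a : ℚ) * x ^ 2 + b * y ^ 2 = c * z ^ 2 := by exact_mod_cast hxyz
  linear_combination this

open scoped NumberTheorySymbols

theorem approx (M : ℕ) (hM : M ≠ 0) (K : ℕ) (x : ∀ p : ℕ, [Fact p.Prime] → ℤ_[p]) (B : ℤ) :
    ∃ z : ℤ, B < z ∧ ∀ (p : ℕ) [Fact p.Prime], p ∣ M → (p : ℤ_[p]) ^ K ∣ (z : ℤ_[p]) - x p := by
  classical
  let a : ℕ → ℕ := fun p => if h : p.Prime then (@PadicInt.appr p ⟨h⟩ (@x p ⟨h⟩) K) else 0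
  obtain ⟨k, hk⟩ := Nat.chineseRemainderOfFinset a (fun p => p ^ K) M.primeFactors
    (fun p hp => pow_ne_zero _ (Nat.prime_of_mem_primeFactors hp).ne_zero)
    (fun p hp q hq hpq => Nat.Coprime.pow _ _ ((Nat.coprime_primes
      (Nat.prime_of_mem_primeFactors hp) (Nat.prime_of_mem_primeFactors hq)).2 hpq))
  obtain ⟨N, hN⟩ : ∃ N : ℕ, B ≤ N := ⟨B.natAbs, Int.le_natAbs⟩
  refine ⟨k + (N + 1) * (M : ℤ) ^ K, ?_, ?_⟩
  · have h1 : (1 : ℤ) ≤ (M : ℤ) ^ K := by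
      have : 0 < M ^ K := pow_pos (Nat.pos_of_ne_zero hM) _
      exact_mod_cast this
    nlinarith [Int.natCast_nonneg k, Int.natCast_nonneg N]
  · intro p hp hpM
    have h1 := hk p (Nat.mem_primeFactors.2 ⟨hp.1, hpM, hM⟩)
    have ha : a p = PadicInt.appr (x p) K := by simp [a, hp.1]
    rw [ha] at h1
    have h2 : ((p : ℤ) ^ K) ∣ (k : ℤ) - (PadicInt.appr (x p) K : ℕ) := by
      have := (Nat.modEq_iff_dvd.1 h1.symm)
      exact_mod_cast this
    rw [← padic_int_dvd (p := p)] at h2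
    have h3 := PadicInt.appr_spec K (x p)
    rw [Ideal.mem_span_singleton] at h3
    have h4 : (p : ℤ_[p]) ^ K ∣ ((N : ℤ_[p]) + 1) * (M : ℤ_[p]) ^ K := by
      apply Dvd.dvd.mul_left
      apply pow_dvd_pow_of_dvd
      exact_mod_cast Nat.cast_dvd_cast (α := ℤ_[p]) hpM
    have := dvd_add (dvd_sub h2 h3) h4
    refine this.trans (dvd_of_eq ?_)
    push_cast
    ring

theorem univ2 {K : Type} [Field K] [CharZero K] (a b x y : K) (ha : a ≠ 0) (hb : b ≠ 0)
    (hxy : x ≠ 0 ∨ y ≠ 0) (h : a * x ^ 2 + b * y ^ 2 = 0) (t : K) :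
    ∃ u v, a * u ^ 2 + b * v ^ 2 = t := by
  have hx : x ≠ 0 := by
    rintro rfl
    have : b * y ^ 2 = 0 := by linear_combination h
    simp_all
  have h2 : (2 : K) ≠ 0 := two_ne_zero
  refine ⟨x * ((t / (a * x ^ 2) + 1) / 2), y * ((t / (a * x ^ 2) - 1) / 2), ?_⟩
  have e : b * y ^ 2 = - (a * x ^ 2) := by linear_combination h
  have : a * x ^ 2 * (((t / (a * x ^ 2) + 1) / 2) ^ 2 - ((t / (a * x ^ 2) - 1) / 2) ^ 2) = t := by
    field_simp
    ring
  linear_combination this + ((t / (a * x ^ 2) - 1) / 2) ^ 2 * e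

theorem split4 {K : Type} [Field K] [CharZero K] (a b c d x y z w : K) (ha : a ≠ 0) (hb : b ≠ 0)
    (hc : c ≠ 0) (hd : d ≠ 0) (hne : x ≠ 0 ∨ y ≠ 0 ∨ z ≠ 0 ∨ w ≠ 0)
    (h : a * x ^ 2 + b * y ^ 2 = c * z ^ 2 + d * w ^ 2) :
    ∃ x y z w : K, a * x ^ 2 + b * y ^ 2 = c * z ^ 2 + d * w ^ 2 ∧ a * x ^ 2 + b * y ^ 2 ≠ 0 := by
  by_cases h0 : a * x ^ 2 + b * y ^ 2 = 0
  · by_cases hxy : x ≠ 0 ∨ y ≠ 0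
    · obtain ⟨u, v, huv⟩ := univ2 a b x y ha hb hxy h0 c
      exact ⟨u, v, 1, 0, by rw [huv]; ring, by rwa [huv]⟩
    · have hzw : z ≠ 0 ∨ w ≠ 0 := by tauto
      obtain ⟨u, v, huv⟩ := univ2 c d z w hc hd hzw (by rw [← h, h0]) a
      exact ⟨1, 0, u, v, by rw [huv]; ring, by simpa using ha⟩
  · exact ⟨x, y, z, w, h, h0⟩

theorem exists_scale {p : ℕ} [Fact p.Prime] (x y z w : ℚ_[p]) :
    ∃ (e : ℚ_[p]) (x' y' z' w' : ℤ_[p]), e ≠ 0 ∧ (x' : ℚ_[p]) = e * x ∧ (y' : ℚ_[p]) = e * y ∧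
      (z' : ℚ_[p]) = e * z ∧ (w' : ℚ_[p]) = e * w := by
  have hp1 : (1 : ℝ) < p := by exact_mod_cast (Fact.out : p.Prime).one_lt
  obtain ⟨n, hn⟩ := pow_unbounded_of_one_lt (‖x‖ + ‖y‖ + ‖z‖ + ‖w‖) hp1
  have hpn : (0 : ℝ) < (p : ℝ) ^ n := by positivity
  have key : ∀ v : ℚ_[p], ‖v‖ ≤ ‖x‖ + ‖y‖ + ‖z‖ + ‖w‖ → ‖(p : ℚ_[p]) ^ n * v‖ ≤ 1 := by
    intro v hv
    rw [norm_mul, Padic.norm_p_pow, zpow_neg, zpow_natCast, inv_mul_le_iff₀ hpn]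
    linarith
  have a1 := norm_nonneg x
  have a2 := norm_nonneg y
  have a3 := norm_nonneg z
  have a4 := norm_nonneg w
  obtain ⟨x', hx⟩ := lift_int _ (key x (by linarith))
  obtain ⟨y', hy⟩ := lift_int _ (key y (by linarith))
  obtain ⟨z', hz⟩ := lift_int _ (key z (by linarith))
  obtain ⟨w', hw⟩ := lift_int _ (key w (by linarith))
  exact ⟨_, x', y', z', w', pow_ne_zero _ (by exact_mod_cast (Fact.out : p.Prime).ne_zero),
    hx, hy, hz, hw⟩

theorem jac_aux (k : ℤ) (n : ℕ) (hn : n ≠ 0)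
    (h : ∀ p : ℕ, p.Prime → p ∣ n → J(k | p) = 1 ∨ Even (n.factorization p))
    (h' : ∀ p : ℕ, p.Prime → p ∣ n → IsCoprime k p) : J(k | n) = 1 := by
  induction n using Nat.recOnPosPrimePosCoprime with
  | zero => exact absurd rfl hn
  | one => simp
  | prime_pow p m hp hm =>
    rw [jacobiSym.pow_right]
    have hd : p ∣ p ^ m := dvd_pow_self p hm.ne'
    rcases h p hp hd with h1 | h1
    · rw [h1, one_pow]
    · rw [hp.factorization_pow, Finsupp.single_eq_same] at h1
      obtain ⟨j, hj⟩ := h1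
      rw [hj, ← two_mul, pow_mul, jacobiSym.sq_one (Int.isCoprime_iff_gcd_eq_one.1 (h' p hp hd)), one_pow]
  | coprime a b ha hb hab iha ihb =>
    have ha0 : a ≠ 0 := by omega
    have hb0 : b ≠ 0 := by omega
    rw [jacobiSym.mul_right' k ha0 hb0, iha ha0, ihb hb0, one_mul]
    · intro p hp hpb
      have := h p hp (hpb.mul_left a)
      rwa [Nat.factorization_mul ha0 hb0, Finsupp.add_apply, Nat.factorization_eq_zero_of_not_dvd
        (fun hpa => Nat.not_coprime_of_dvd_of_dvd hp.one_lt hpa hpb hab), zero_add] at this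
    · intro p hp hpb
      exact h' p hp (hpb.mul_left a)
    · intro p hp hpa
      have := h p hp (hpa.mul_right b)
      rwa [Nat.factorization_mul ha0 hb0, Finsupp.add_apply,
        Nat.factorization_eq_zero_of_not_dvd (n := b)
        (fun hpb => Nat.not_coprime_of_dvd_of_dvd hp.one_lt hpa hpb hab), add_zero] at this
    · intro p hp hpa
      exact h' p hp (hpa.mul_right b)

theorem jac (a b : ℤ) (m n : ℕ) (hn : n ≠ 0) (x y : ℤ) (h : a * x ^ 2 + b * y ^ 2 = m * n)
    (hcop : ∀ p : ℕ, p.Prime → p ∣ n → ¬ (p : ℤ) ∣ a ∧ ¬ (p : ℤ) ∣ b ∧ ¬ p ∣ m) :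
    J(-(a * b) | n) = 1 := by
  have hpab : ∀ p : ℕ, p.Prime → p ∣ n → ¬ (p : ℤ) ∣ -(a * b) := by
    intro p hp hpn
    obtain ⟨h1, h2, h3⟩ := hcop p hp hpn
    rw [dvd_neg, (Nat.prime_iff_prime_int.1 hp).dvd_mul]
    tauto
  apply jac_aux _ _ hn
  · intro p hp hpn
    obtain ⟨h1, h2, h3⟩ := hcop p hp hpn
    have : Fact p.Prime := ⟨hp⟩
    by_cases hev : Even (n.factorization p)
    · exact Or.inr hev
    left
    rw [Nat.not_even_iff_odd] at hev
    obtain ⟨j, hj⟩ := hev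
    obtain ⟨n', hn', hpn'⟩ : ∃ n', n = p ^ n.factorization p * n' ∧ ¬ p ∣ n' :=
      ⟨n / p ^ n.factorization p, (Nat.ordProj_mul_ordCompl_eq_self n p).symm,
        Nat.not_dvd_ordCompl hp hn⟩
    rw [hj] at hn'
    have hI : I3 ℚ_[p] ((-(m * p * n') : ℤ)) a b := by
      have hp0 : (p : ℚ_[p]) ≠ 0 := by exact_mod_cast hp.ne_zero
      refine ⟨p ^ j, x, y, Or.inl (pow_ne_zero _ hp0), ?_⟩
      have h' : (a : ℚ_[p]) * x ^ 2 + b * y ^ 2 = m * (p ^ (2 * j + 1) * n') := by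
        rw [hn'] at h
        exact_mod_cast congrArg (Int.cast : ℤ → ℚ_[p]) h
      push_cast
      linear_combination h'
    have hmn : ¬ (p : ℤ) ∣ m * n' := by
      rw [(Nat.prime_iff_prime_int.1 hp).dvd_mul, Int.natCast_dvd_natCast, Int.natCast_dvd_natCast]
      tauto
    have hsq := resid _ _ _ ⟨-(m * n'), by ring⟩ (by
      intro hd
      apply hmn
      obtain ⟨e, he⟩ := hd
      refine ⟨-e, ?_⟩
      have : (p : ℤ) ≠ 0 := by exact_mod_cast hp.ne_zero
      apply mul_left_cancel₀ this
      linear_combination -he) h1 h2 hI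
    rw [← jacobiSym.legendreSym.to_jacobiSym, legendreSym.eq_one_iff]
    · exact_mod_cast hsq
    · rw [Ne, ZMod.intCast_zmod_eq_zero_iff_dvd]
      exact hpab p hp hpn
  · intro p hp hpn
    exact ((Nat.prime_iff_prime_int.1 hp).coprime_iff_not_dvd.2 (hpab p hp hpn)).symm

theorem loc (A B : ℤ) (M m n q : ℕ) (hq : q.Prime) (hA : A ∣ M) (hB : B ∣ M) (hB0 : B ≠ 0)
    (hm : ∀ p : ℕ, p.Prime → p ∣ m → p ∣ M) (x y : ℤ) (h : A * x ^ 2 + B * y ^ 2 = m * n)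
    (hcop : n.Coprime M) (hmod : q ≡ n [MOD M]) (hJ : J(-(A * B) | q) = 1)
    (p : ℕ) [Fact p.Prime] (hp2 : p ≠ 2) : I3 ℚ_[p] A B (-(m * q : ℕ)) := by
  have hp : p.Prime := Fact.out
  have two1 : ‖(2 : ℤ_[p])‖ = 1 := by
    rw [← toZMod_ne, map_ofNat]
    exact Ring.two_ne_zero (by rwa [ZMod.ringChar_zmod_n p])
  have int1 : ∀ k : ℤ, ¬ (p : ℤ) ∣ k → ‖(k : ℤ_[p])‖ = 1 := by
    intro k hk
    rw [← toZMod_ne, map_intCast, Ne, ZMod.intCast_zmod_eq_zero_iff_dvd]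
    exact hk
  by_cases hpM : p ∣ M
  · have hpn : ¬ p ∣ n := fun hpn => Nat.not_coprime_of_dvd_of_dvd hp.one_lt hpn hpM hcop
    have h1 : ‖((n : ℤ) : ℤ_[p])‖ = 1 := int1 n (by rwa [Int.natCast_dvd_natCast])
    have h2 : ‖(((q : ℤ) - n : ℤ) : ℤ_[p])‖ < 1 := by
      rw [← toZMod_zero, map_intCast, ZMod.intCast_zmod_eq_zero_iff_dvd]
      have := Nat.modEq_iff_dvd.1 hmod.symm
      exact (Int.natCast_dvd_natCast.2 hpM).trans this
    have h4 : ‖(4 : ℚ_[p])‖ = 1 := by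
      have e : (4 : ℚ_[p]) = ((2 : ℤ_[p]) : ℚ_[p]) ^ 2 := by
        have : ((2 : ℤ_[p]) : ℚ_[p]) = 2 := rfl
        rw [this]; norm_num
      rw [e, norm_pow, ← PadicInt.norm_def, two1, one_pow]
    rw [PadicInt.norm_def] at h1 h2
    push_cast at h1 h2
    obtain ⟨c, hc, hqc⟩ := close_sq (q : ℚ_[p]) n (by rw [← norm_pos_iff, h1]; exact one_pos)
      (by rw [h1, h4, one_mul]; exact h2)
    refine ⟨x * c, y * c, 1, by simp, ?_⟩
    have h' : (A : ℚ_[p]) * x ^ 2 + B * y ^ 2 = m * n := by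
      exact_mod_cast congrArg (Int.cast : ℤ → ℚ_[p]) h
    push_cast
    rw [hqc]
    linear_combination c ^ 2 * h'
  by_cases hpq : p = q
  · subst hpq
    have hne : ((-(A * B) : ℤ) : ZMod p) ≠ 0 := by
      intro h0
      rw [← jacobiSym.legendreSym.to_jacobiSym, (legendreSym.eq_zero_iff p _).2 h0] at hJ
      exact zero_ne_one hJ
    rw [← jacobiSym.legendreSym.to_jacobiSym, legendreSym.eq_one_iff _ hne] at hJ
    obtain ⟨r, hr⟩ := hJ
    obtain ⟨r, rfl⟩ := ZMod.ringHom_surjective (PadicInt.toZMod (p := p)) r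
    obtain ⟨g, hg⟩ := sq_hensel r ((-(A * B) : ℤ) : ℤ_[p]) (by
      have hr1 : ‖r‖ = 1 := by
        rw [← toZMod_ne]
        intro h0
        rw [h0] at hr
        exact hne (by rw [hr]; simp)
      rw [norm_mul, two1, hr1, one_mul, one_pow, ← toZMod_zero]
      rw [map_sub, map_pow, map_intCast, hr]
      ring)
    refine ⟨B, g, 0, Or.inl (by exact_mod_cast hB0), ?_⟩
    have hg' : (g : ℚ_[p]) ^ 2 = -(A * B) := by
      have := congrArg (fun x : ℤ_[p] => (x : ℚ_[p])) hg
      simpa using this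
    rw [hg']
    ring
  · have h1 : ¬ (p : ℤ) ∣ A := fun hd => hpM (Int.natCast_dvd_natCast.1 (hd.trans hA))
    have h2 : ¬ (p : ℤ) ∣ B := fun hd => hpM (Int.natCast_dvd_natCast.1 (hd.trans hB))
    have h3 : ¬ (p : ℤ) ∣ (-(m * q : ℕ) : ℤ) := by
      rw [dvd_neg, Int.natCast_dvd_natCast, hp.dvd_mul]
      rintro (hd | hd)
      · exact hpM (hm p hp hd)
      · exact hpq ((Nat.prime_dvd_prime_iff_eq hp hq).1 hd)
    have := unit3 hp2 _ _ _ (int1 _ h1) (int1 _ h2) (int1 _ h3)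
    exact_mod_cast this

open scoped NumberTheorySymbols

theorem numcore (a b c d M k0 s0 s1 : ℕ) (ha : 0 < a) (hb : 0 < b) (hc : 0 < c) (hd : 0 < d)
    (hM : M = 8 * a * b * c * d) (x y z w : ℤ) (h0 : (a : ℤ) * x ^ 2 + b * y ^ 2 = s0)
    (h1 : (c : ℤ) * z ^ 2 - d * w ^ 2 = s1) (hs0 : s0 ≠ 0) (hs1 : s1 ≠ 0)
    (hndvd : ∀ p : ℕ, p.Prime → p ∣ M → ¬ p ^ (k0 + 1) ∣ s0)
    (hdvd : ∀ p : ℕ, p.Prime → p ∣ M → ((p : ℤ) ^ (M ^ (k0 + 1))) ∣ (s0 : ℤ) - s1) :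
    ∃ T : ℕ, 0 < T ∧ I3 ℚ a b (-T) ∧ I3 ℚ d T (-c) := by
  have hM0 : M ≠ 0 := by rw [hM]; positivity
  have hMK : M ^ (k0 + 1) ≠ 0 := pow_ne_zero _ hM0
  have hcong : s0 ≡ s1 [MOD M ^ (k0 + 1)] := by
    rw [Nat.modEq_iff_dvd]
    rw [← dvd_neg, neg_sub, Int.natCast_dvd]
    rw [Nat.dvd_iff_prime_pow_dvd_dvd]
    intro p k hp hk
    rcases Nat.eq_zero_or_pos k with rfl | hk0
    · simp
    have hpM : p ∣ M := hp.dvd_of_dvd_pow ((dvd_pow_self p hk0.ne').trans hk)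
    have hkle : k ≤ M ^ (k0 + 1) :=
      (Nat.lt_pow_self hp.one_lt).le.trans (Nat.le_of_dvd (Nat.pos_of_ne_zero hMK) hk)
    have := hdvd p hp hpM
    rw [← Int.natCast_dvd]
    push_cast
    exact (pow_dvd_pow _ hkle).trans this
  obtain ⟨m, hmdef⟩ : ∃ m, m = Nat.gcd s0 (M ^ (k0 + 1)) := ⟨_, rfl⟩
  have hm' : m = Nat.gcd s1 (M ^ (k0 + 1)) := by
    rw [hmdef]; exact hcong.gcd_eq
  have hm0 : 0 < m := by rw [hmdef]; exact Nat.gcd_pos_of_pos_left _ (Nat.pos_of_ne_zero hs0)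
  have hmM : m ∣ M ^ k0 := by
    rw [Nat.dvd_iff_prime_pow_dvd_dvd]
    intro p k hp hk
    rcases Nat.eq_zero_or_pos k with rfl | hk0
    · simp
    have hmM : m ∣ M ^ (k0 + 1) := by rw [hmdef]; exact Nat.gcd_dvd_right _ _
    have hpM : p ∣ M := hp.dvd_of_dvd_pow ((dvd_pow_self p hk0.ne').trans (hk.trans hmM))
    have hkk : k ≤ k0 := by
      by_contra hcon
      apply hndvd p hp hpM
      refine (pow_dvd_pow p (by omega : k0 + 1 ≤ k)).trans (hk.trans ?_)
      rw [hmdef]; exact Nat.gcd_dvd_left _ _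
    exact (pow_dvd_pow p hkk).trans (pow_dvd_pow_of_dvd hpM _)
  have hmp : ∀ p : ℕ, p.Prime → p ∣ m → p ∣ M := fun p hp h =>
    hp.dvd_of_dvd_pow (h.trans hmM)
  obtain ⟨n0, hn0⟩ : m ∣ s0 := by rw [hmdef]; exact Nat.gcd_dvd_left _ _
  obtain ⟨n1, hn1⟩ : m ∣ s1 := by rw [hm']; exact Nat.gcd_dvd_left _ _
  have hmMd : m * M ∣ M ^ (k0 + 1) := by
    rw [pow_succ]; exact mul_dvd_mul_right hmM M
  have hcong' : n0 ≡ n1 [MOD M] := by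
    have := hcong.of_dvd hmMd
    rw [hn0, hn1] at this
    exact Nat.ModEq.mul_left_cancel' hm0.ne' this
  have hcop0 : n0.Coprime M := by
    apply Nat.Coprime.symm
    apply Nat.coprime_of_dvd
    intro p hp hpM hpn
    have : m * p ∣ m := by
      conv_rhs => rw [hmdef]
      apply Nat.dvd_gcd
      · rw [hn0]; exact mul_dvd_mul_left m hpn
      · exact (mul_dvd_mul_left m hpM).trans hmMd
    have := Nat.le_of_dvd hm0 this
    have := hp.two_le
    nlinarith
  have hcop1 : n1.Coprime M := by
    have := hcong'.gcd_eq
    rw [Nat.Coprime, ← this]; exact hcop0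
  have hn00 : n0 ≠ 0 := by rintro rfl; exact hs0 (by rw [hn0, mul_zero])
  have hn10 : n1 ≠ 0 := by rintro rfl; exact hs1 (by rw [hn1, mul_zero])
  obtain ⟨q, -, hq, hqn⟩ := Nat.forall_exists_prime_gt_and_modEq 0 hM0 hcop0
  have hJmod : ∀ (k : ℤ) (u v : ℕ), 4 * k.natAbs ∣ M → u.Coprime M → u ≡ v [MOD M] →
      J(k | u) = J(k | v) := by
    intro k u v hk hu huv
    have h2M : 2 ∣ M := ⟨4 * a * b * c * d, by rw [hM]; ring⟩
    have hvM : v.Coprime M := by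
      have := huv.gcd_eq
      rw [Nat.Coprime, ← this]; exact hu
    have ou : Odd u := Nat.Coprime.odd_of_right (hu.coprime_dvd_right h2M)
    have ov : Odd v := Nat.Coprime.odd_of_right (hvM.coprime_dvd_right h2M)
    rw [jacobiSym.mod_right k ou, jacobiSym.mod_right k ov, huv.of_dvd hk]
  have hqM : q.Coprime M := by
    have := hqn.gcd_eq
    rw [Nat.Coprime, this]; exact hcop0
  have hpd : ∀ (e : ℤ) (n : ℕ), n.Coprime M → e ∣ M → ∀ p : ℕ, p.Prime → p ∣ n → ¬ (p : ℤ) ∣ e := by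
    intro e n hn he p hp hpn hpe
    exact Nat.not_coprime_of_dvd_of_dvd hp.one_lt hpn (Int.natCast_dvd_natCast.1 (hpe.trans he)) hn
  have dA : (a : ℤ) ∣ M := Int.natCast_dvd_natCast.2 ⟨8 * b * c * d, by rw [hM]; ring⟩
  have dB : (b : ℤ) ∣ M := Int.natCast_dvd_natCast.2 ⟨8 * a * c * d, by rw [hM]; ring⟩
  have dC : (c : ℤ) ∣ M := Int.natCast_dvd_natCast.2 ⟨8 * a * b * d, by rw [hM]; ring⟩
  have dD : (-d : ℤ) ∣ M := by
    rw [neg_dvd]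
    exact Int.natCast_dvd_natCast.2 ⟨8 * a * b * c, by rw [hM]; ring⟩
  have e0 : (a : ℤ) * x ^ 2 + b * y ^ 2 = m * n0 := by rw [h0, hn0]; push_cast; ring
  have e1 : (c : ℤ) * z ^ 2 + (-d : ℤ) * w ^ 2 = m * n1 := by
    rw [hn1] at h1; push_cast at h1; linear_combination h1
  have j0 : J(-((a : ℤ) * b) | q) = 1 := by
    rw [hJmod _ q n0 _ hqM hqn]
    · exact jac a b m n0 hn00 x y e0 (fun p hp hpn => ⟨hpd _ _ hcop0 dA p hp hpn,
        hpd _ _ hcop0 dB p hp hpn, fun h => Nat.not_coprime_of_dvd_of_dvd hp.one_lt hpn (hmp p hp h) hcop0⟩)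
    · rw [Int.natAbs_neg, Int.natAbs_mul, Int.natAbs_natCast, Int.natAbs_natCast]
      exact ⟨2 * c * d, by rw [hM]; ring⟩
  have j1 : J(-((c : ℤ) * (-d)) | q) = 1 := by
    rw [hJmod _ q n1 _ hqM (hqn.trans hcong')]
    · exact jac c (-d) m n1 hn10 z w e1 (fun p hp hpn => ⟨hpd _ _ hcop1 dC p hp hpn,
        hpd _ _ hcop1 dD p hp hpn, fun h => Nat.not_coprime_of_dvd_of_dvd hp.one_lt hpn (hmp p hp h) hcop1⟩)
    · rw [Int.natAbs_neg, Int.natAbs_mul, Int.natAbs_neg, Int.natAbs_natCast, Int.natAbs_natCast]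
      exact ⟨2 * a * b, by rw [hM]; ring⟩
  have hT : 0 < m * q := Nat.mul_pos hm0 hq.pos
  refine ⟨m * q, hT, ?_, ?_⟩
  · refine legendre _ a b (m * q) ha hb hT rfl ?_
    intro p _ hp2
    have := loc a b M m n0 q hq dA dB (by exact_mod_cast hb.ne') hmp x y e0 hcop0 hqn j0 p hp2
    exact_mod_cast this
  · refine legendre _ d (m * q) c hd hT hc rfl ?_
    intro p _ hp2
    have := loc c (-d) M m n1 q hq dC dD (by simpa using hd.ne') hmp z w e1 hcop1
      (hqn.trans hcong') j1 p hp2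
    obtain ⟨x, y, z, hne, h⟩ := this
    refine ⟨y, z, x, by tauto, ?_⟩
    push_cast at h ⊢
    linear_combination -h

/-- the rational conclusion -/
def I4 (K : Type) [Field K] (a b d c : K) : Prop :=
  ∃ x y w z : K, (x ≠ 0 ∨ y ≠ 0 ∨ w ≠ 0 ∨ z ≠ 0) ∧ a * x ^ 2 + b * y ^ 2 + d * w ^ 2 = c * z ^ 2

theorem combine {K : Type} [Field K] (a b c d T : K) (hT : T ≠ 0) (h1 : I3 K a b (-T)) (h2 : I3 K d T (-c)) :
    I4 K a b d c := by
  obtain ⟨x, y, u, hne, h⟩ := h1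
  obtain ⟨w, v, z, hne', h'⟩ := h2
  by_cases hu : u = 0
  · subst hu
    exact ⟨x, y, 0, 0, by tauto, by linear_combination h⟩
  by_cases hv : v = 0
  · subst hv
    exact ⟨0, 0, w, z, by tauto, by linear_combination h'⟩
  refine ⟨x * v, y * v, w * u, z * u, ?_, by linear_combination v ^ 2 * h + u ^ 2 * h'⟩
  have := hne'
  simp only [ne_eq, mul_eq_zero, hu, hv, or_false]
  by_contra hcon
  push Not at hcon
  obtain ⟨rfl, rfl, rfl, rfl⟩ := hcon
  rcases hne with hne | hne | hne
  · exact hne rfl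
  · exact hne rfl
  · have : -T * u ^ 2 = 0 := by linear_combination h
    exact hT (by simpa [hu] using this)

theorem sup_bound (M : ℕ) (hM : M ≠ 0) (k : ∀ p : ℕ, [Fact p.Prime] → ℕ) :
    ∃ k0, ∀ (p : ℕ) [Fact p.Prime], p ∣ M → k p ≤ k0 := by
  classical
  refine ⟨M.primeFactors.sup (fun p => if h : p.Prime then @k p ⟨h⟩ else 0), ?_⟩
  intro p hp hpM
  have := Finset.le_sup (f := fun p => if h : p.Prime then @k p ⟨h⟩ else 0)
    (Nat.mem_primeFactors.2 ⟨hp.1, hpM, hM⟩)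
  simpa [hp.1] using this

theorem not_pow_dvd {p : ℕ} [Fact p.Prime] (s : ℤ_[p]) (hs : s ≠ 0) :
    ∃ k : ℕ, ¬ (p : ℤ_[p]) ^ (k + 1) ∣ s := by
  refine ⟨s.valuation, fun h => ?_⟩
  have h1 := (PadicInt.mem_span_pow_iff_le_valuation s hs (s.valuation + 1)).1
    (Ideal.mem_span_singleton.2 h)
  omega

theorem dvd_quad {p : ℕ} [Fact p.Prime] (q a b x y X Y : ℤ_[p]) (hx : q ∣ x - X) (hy : q ∣ y - Y) :
    q ∣ (a * x ^ 2 + b * y ^ 2) - (a * X ^ 2 + b * Y ^ 2) := by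
  have : (a * x ^ 2 + b * y ^ 2) - (a * X ^ 2 + b * Y ^ 2) =
      (x - X) * (a * (x + X)) + (y - Y) * (b * (y + Y)) := by ring
  rw [this]
  exact dvd_add (hx.mul_right _) (hy.mul_right _)

theorem quat (a b c d : ℕ) (ha : 0 < a) (hb : 0 < b) (hc : 0 < c) (hd : 0 < d)
    (h : ∀ (p : ℕ) [Fact p.Prime], I4 ℚ_[p] a b d c) : I4 ℚ a b d c := by
  obtain ⟨M, hM⟩ : ∃ M, M = 8 * a * b * c * d := ⟨_, rfl⟩
  have hM0 : M ≠ 0 := by rw [hM]; positivity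
  have key : ∀ (p : ℕ) [Fact p.Prime], ∃ (X Y Z W : ℤ_[p]) (k : ℕ),
      (a : ℤ_[p]) * X ^ 2 + b * Y ^ 2 = c * Z ^ 2 + (-d) * W ^ 2 ∧
      ¬ (p : ℤ_[p]) ^ (k + 1) ∣ (a : ℤ_[p]) * X ^ 2 + b * Y ^ 2 := by
    intro p _
    obtain ⟨x, y, w, z, hne, h⟩ := h p
    obtain ⟨x, y, z, w, e1, e2⟩ := split4 (a : ℚ_[p]) b c (-d) x y z w
      (by exact_mod_cast ha.ne') (by exact_mod_cast hb.ne') (by exact_mod_cast hc.ne')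
      (by simpa using hd.ne') (by tauto) (by linear_combination h)
    obtain ⟨e, X, Y, Z, W, he, hX, hY, hZ, hW⟩ := exists_scale x y z w
    have h0 : (((a : ℤ_[p]) * X ^ 2 + b * Y ^ 2 : ℤ_[p]) : ℚ_[p]) = e ^ 2 * (a * x ^ 2 + b * y ^ 2) := by
      push_cast
      rw [hX, hY]; ring
    obtain ⟨k, hk⟩ := not_pow_dvd ((a : ℤ_[p]) * X ^ 2 + (b : ℤ_[p]) * Y ^ 2) (by
      intro h00
      rw [h00] at h0
      have : e ^ 2 * (a * x ^ 2 + b * y ^ 2) = 0 := by rw [← h0]; rfl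
      rcases mul_eq_zero.1 this with h | h
      · exact he (by simpa using h)
      · exact e2 h)
    refine ⟨X, Y, Z, W, k, ?_, hk⟩
    apply Subtype.coe_injective
    change (((a : ℤ_[p]) * X ^ 2 + b * Y ^ 2 : ℤ_[p]) : ℚ_[p]) = ((c * Z ^ 2 + (-d) * W ^ 2 : ℤ_[p]) : ℚ_[p])
    rw [h0, e1]
    push_cast
    rw [hZ, hW]; ring
  choose X Y Z W k h1 h2 using key
  obtain ⟨k0, hk0⟩ := sup_bound M hM0 (fun p => k p)
  obtain ⟨x, hx0, hx⟩ := approx M hM0 (M ^ (k0 + 1)) (fun p => X p) 0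
  obtain ⟨y, -, hy⟩ := approx M hM0 (M ^ (k0 + 1)) (fun p => Y p) 0
  obtain ⟨w, -, hw⟩ := approx M hM0 (M ^ (k0 + 1)) (fun p => W p) 0
  obtain ⟨z, hz0, hz⟩ := approx M hM0 (M ^ (k0 + 1)) (fun p => Z p) (d * w ^ 2)
  have hs0 : 0 < (a : ℤ) * x ^ 2 + b * y ^ 2 := by positivity
  have hs1 : 0 < (c : ℤ) * z ^ 2 - d * w ^ 2 := by
    have : (1 : ℤ) ≤ c := by exact_mod_cast hc
    have h3 : (0 : ℤ) ≤ d * w ^ 2 := by positivity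
    have h4 : z ≤ z ^ 2 := by nlinarith
    have h5 : z ^ 2 ≤ c * z ^ 2 := by nlinarith [sq_nonneg z]
    linarith
  obtain ⟨s0, e0⟩ := Int.eq_ofNat_of_zero_le hs0.le
  obtain ⟨s1, e1⟩ := Int.eq_ofNat_of_zero_le hs1.le
  have a0 : ∀ (p : ℕ) [Fact p.Prime], p ∣ M → (p : ℤ_[p]) ^ (M ^ (k0 + 1)) ∣
      (s0 : ℤ_[p]) - (a * X p ^ 2 + b * Y p ^ 2) := by
    intro p _ hpM
    have := dvd_quad _ (a : ℤ_[p]) b _ _ _ _ (hx p hpM) (hy p hpM)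
    have e : (a : ℤ_[p]) * x ^ 2 + b * y ^ 2 = s0 := by
      exact_mod_cast congrArg (Int.cast : ℤ → ℤ_[p]) e0
    rwa [e] at this
  have a1 : ∀ (p : ℕ) [Fact p.Prime], p ∣ M → (p : ℤ_[p]) ^ (M ^ (k0 + 1)) ∣
      (s1 : ℤ_[p]) - (a * X p ^ 2 + b * Y p ^ 2) := by
    intro p _ hpM
    have := dvd_quad _ (c : ℤ_[p]) (-d) _ _ _ _ (hz p hpM) (hw p hpM)
    have e : (c : ℤ_[p]) * z ^ 2 + (-d) * w ^ 2 = s1 := by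
      have : (c : ℤ_[p]) * z ^ 2 - d * w ^ 2 = s1 := by
        exact_mod_cast congrArg (Int.cast : ℤ → ℤ_[p]) e1
      linear_combination this
    rwa [e, ← h1] at this
  obtain ⟨T, hT, i1, i2⟩ := numcore a b c d M k0 s0 s1 ha hb hc hd hM x y z w e0 e1
    (by rintro rfl; rw [e0] at hs0; simp at hs0) (by rintro rfl; rw [e1] at hs1; simp at hs1)
    (by
      intro p hp hpM hd
      have : Fact p.Prime := ⟨hp⟩
      have hle : k0 + 1 ≤ M ^ (k0 + 1) := by
        have : 1 < M := lt_of_lt_of_le hp.one_lt (Nat.le_of_dvd (Nat.pos_of_ne_zero hM0) hpM)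
        exact (Nat.lt_pow_self this).le
      apply h2 p
      refine (pow_dvd_pow _ (Nat.succ_le_succ (hk0 p hpM))).trans ?_
      have b1 := (pow_dvd_pow _ hle).trans (a0 p hpM)
      have b2 : (p : ℤ_[p]) ^ (k0 + 1) ∣ (s0 : ℤ_[p]) := by
        exact_mod_cast Nat.cast_dvd_cast (α := ℤ_[p]) hd
      exact (dvd_sub_right b2).1 b1)
    (by
      intro p hp hpM
      have : Fact p.Prime := ⟨hp⟩
      rw [← padic_int_dvd (p := p)]
      have := dvd_sub (a0 p hpM) (a1 p hpM)
      push_cast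
      rwa [sub_sub_sub_cancel_right] at this)
  exact combine _ _ _ _ (T : ℚ) (by exact_mod_cast hT.ne') i1 i2


theorem mod8_nat : ∀ b ∈ [1,3,5,7], ∀ c ∈ [1,3,5,7], ∀ d ∈ [1,2,3,5,6,7], ∀ e ∈ [1,2,3,5,6,7],
    ∃ x ∈ [0,1,2], ∃ y ∈ [0,1,2], ∃ z ∈ [0,1,2], ∃ v ∈ [0,1,2], ∃ w ∈ [0,1,2],
      (x = 1 ∨ y = 1 ∨ z = 1) ∧ (x^2+b*y^2+c*z^2+d*v^2+e*w^2) % 8 = 0 := by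
  decide +kernel

theorem pigeon : ∀ e : Fin 5 → Bool, ∃ σ : Equiv.Perm (Fin 5),
    e (σ 0) = e (σ 1) ∧ e (σ 1) = e (σ 2) := by
  decide +kernel

theorem odd8 : ∀ a : ZMod 8, (∃ b, a * b = 1) → a * a = 1 ∧ ∃ n ∈ [1,3,5,7], a = (n : ℕ) := by
  decide +kernel

theorem even8 : ∀ a : ZMod 8, (∃ b, a * b = 1) → ∃ n ∈ [2,6], 2 * a = (n : ℕ) := by
  decide +kernel

theorem mod8 (a b c d e : ZMod 8) (ha : ∃ a', a * a' = 1) (hb : ∃ b', b * b' = 1)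
    (hc : ∃ c', c * c' = 1) (hd : ∃ d' d'', d' * d'' = 1 ∧ (d = d' ∨ d = 2 * d'))
    (he : ∃ e' e'', e' * e'' = 1 ∧ (e = e' ∨ e = 2 * e')) :
    ∃ x y z v w : ℕ, (x = 1 ∨ y = 1 ∨ z = 1) ∧
      a * x ^ 2 + b * y ^ 2 + c * z ^ 2 + d * v ^ 2 + e * w ^ 2 = 0 := by
  obtain ⟨haa, -⟩ := odd8 a ha
  have hmul : ∀ b : ZMod 8, (∃ b', b * b' = 1) → ∃ n ∈ [1,3,5,7], a * b = (n : ℕ) := by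
    intro b hb
    obtain ⟨b', hb⟩ := hb
    exact (odd8 (a * b) ⟨a * b', by linear_combination haa * b * b' + hb⟩).2
  have hmul2 : ∀ d : ZMod 8, (∃ d' d'', d' * d'' = 1 ∧ (d = d' ∨ d = 2 * d')) →
      ∃ n ∈ [1,2,3,5,6,7], a * d = (n : ℕ) := by
    rintro d ⟨d', d'', h, rfl | rfl⟩
    · obtain ⟨n, hn, h⟩ := hmul d ⟨_, h⟩
      refine ⟨n, ?_, h⟩
      simp at hn ⊢
      omega
    · obtain ⟨n, hn, h⟩ := even8 (a * d') ⟨a * d'', by linear_combination haa * d' * d'' + h⟩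
      refine ⟨n, ?_, by linear_combination h⟩
      simp at hn ⊢
      omega
  obtain ⟨b1, hb1, hb⟩ := hmul b hb
  obtain ⟨c1, hc1, hc⟩ := hmul c hc
  obtain ⟨d1, hd1, hd⟩ := hmul2 d hd
  obtain ⟨e1, he1, he⟩ := hmul2 e he
  obtain ⟨x, -, y, -, z, -, v, -, w, -, h1, h2⟩ := mod8_nat b1 hb1 c1 hc1 d1 hd1 e1 he1
  refine ⟨x, y, z, v, w, h1, ?_⟩
  have h3 := (ZMod.natCast_eq_zero_iff _ 8).2 (Nat.dvd_of_mod_eq_zero h2)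
  push_cast at h3
  rw [← hb, ← hc, ← hd, ← he] at h3
  linear_combination a * h3 - (b * y ^ 2 + c * z ^ 2 + d * v ^ 2 + e * w ^ 2) * haa

theorem lift8 (a R : ℤ_[2]) (ha : ‖a‖ = 1) (h : PadicInt.toZModPow 3 (a + R) = 0) :
    ∃ X : ℤ_[2], X ≠ 0 ∧ a * X ^ 2 + R = 0 := by
  obtain ⟨a', ha'⟩ := (PadicInt.isUnit_iff.2 ha).exists_right_inv
  obtain ⟨X, hX⟩ := sq_hensel 1 (-(a' * R)) (by
    rw [← RingHom.mem_ker, PadicInt.ker_toZModPow, Ideal.mem_span_singleton] at h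
    have h1 : ((2 : ℕ) : ℤ_[2]) ^ 3 ∣ 1 ^ 2 - -(a' * R) := by
      refine (h.mul_left a').trans (dvd_of_eq ?_)
      linear_combination ha'
    rw [← Ideal.mem_span_singleton, ← PadicInt.norm_le_pow_iff_mem_span_pow] at h1
    refine lt_of_le_of_lt h1 ?_
    have h2 : ‖(2 : ℤ_[2])‖ = 2⁻¹ := by
      have := PadicInt.norm_p (p := 2)
      exact_mod_cast this
    rw [mul_one, h2]
    norm_num)
  have hXR : a * X ^ 2 + R = 0 := by rw [hX]; linear_combination -R * ha'
  refine ⟨X, ?_, hXR⟩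
  rintro rfl
  have hR : R = 0 := by linear_combination hXR
  rw [hR, add_zero] at h
  have h1 := congrArg (PadicInt.toZModPow 3) ha'
  rw [map_mul, h, zero_mul, map_one] at h1
  revert h1
  decide

def Iso5 (K : Type) [Field K] (c : Fin 5 → K) : Prop :=
  ∃ x : Fin 5 → K, x ≠ 0 ∧ ∑ i, c i * x i ^ 2 = 0

theorem Iso5.perm {K : Type} [Field K] (c : Fin 5 → K) (σ : Equiv.Perm (Fin 5))
    (h : Iso5 K (c ∘ σ)) : Iso5 K c := by
  obtain ⟨x, hx, h⟩ := h
  refine ⟨x ∘ σ.symm, ?_, ?_⟩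
  · intro h0
    apply hx
    ext i
    simpa using congrFun h0 (σ i)
  · rw [← h, ← Equiv.sum_comp σ]
    simp

theorem Iso5.scale {K : Type} [Field K] (c c' s : Fin 5 → K) (k : K) (hs : ∀ i, s i ≠ 0)
    (hk : k ≠ 0) (hc : ∀ i, k * c i * s i ^ 2 = c' i) (h : Iso5 K c') : Iso5 K c := by
  obtain ⟨x, hx, h⟩ := h
  refine ⟨fun i => s i * x i, ?_, ?_⟩
  · intro h0
    apply hx
    ext i
    have := congrFun h0 i
    simpa [hs i] using this
  · apply mul_left_cancel₀ hk
    rw [mul_zero, ← h, Finset.mul_sum]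
    refine Finset.sum_congr rfl fun i _ => ?_
    rw [← hc]; ring

theorem nf {p : ℕ} [Fact p.Prime] (c : ℚ_[p]) (hc : c ≠ 0) :
    ∃ (e : Bool) (u : ℤ_[p]) (s : ℚ_[p]), ‖u‖ = 1 ∧ s ≠ 0 ∧
      c * s ^ 2 = (if e then (p : ℚ_[p]) else 1) * u := by
  have hp : (p : ℚ_[p]) ≠ 0 := by exact_mod_cast (Fact.out : p.Prime).ne_zero
  have hpr : (p : ℝ) ≠ 0 := by exact_mod_cast (Fact.out : p.Prime).ne_zero
  have hn : ‖c * (p : ℚ_[p]) ^ (-c.valuation)‖ = 1 := by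
    rw [norm_mul, Padic.norm_eq_zpow_neg_valuation hc, Padic.norm_p_zpow, ← zpow_add₀ hpr]
    simp
  obtain ⟨u, hu⟩ := lift_int _ hn.le
  have hu1 : ‖u‖ = 1 := by rw [PadicInt.norm_def, hu, hn]
  have hc' : c = (p : ℚ_[p]) ^ c.valuation * u := by
    rw [hu, mul_comm, mul_assoc, ← zpow_add₀ hp]; simp
  generalize c.valuation = v at hc'
  rcases Int.even_or_odd' v with ⟨j, rfl | rfl⟩
  · refine ⟨false, u, p ^ (-j), hu1, zpow_ne_zero _ hp, ?_⟩
    rw [hc', ← zpow_natCast, ← zpow_mul, mul_right_comm, ← zpow_add₀ hp]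
    simp
    ring_nf
    simp
  · refine ⟨true, u, p ^ (-j), hu1, zpow_ne_zero _ hp, ?_⟩
    rw [hc', ← zpow_natCast, ← zpow_mul, mul_right_comm, ← zpow_add₀ hp]
    have : 2 * j + 1 + -j * (2 : ℕ) = 1 := by push_cast; ring
    rw [this]
    simp

theorem two5 (a b c d e : ℤ_[2]) (k l : Bool) (ha : ‖a‖ = 1) (hb : ‖b‖ = 1) (hc : ‖c‖ = 1)
    (hd : ‖d‖ = 1) (he : ‖e‖ = 1) :
    Iso5 ℚ_[2] ![(a : ℚ_[2]), b, c, (if k then 2 else 1) * d, (if l then 2 else 1) * e] := by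
  have hu : ∀ a : ℤ_[2], ‖a‖ = 1 → ∃ b, PadicInt.toZModPow 3 a * b = 1 := by
    intro a ha
    obtain ⟨a', ha'⟩ := (PadicInt.isUnit_iff.2 ha).exists_right_inv
    exact ⟨PadicInt.toZModPow 3 a', by rw [← map_mul, ha', map_one]⟩
  have hu2 : ∀ (a : ℤ_[2]) (k : Bool), ‖a‖ = 1 → ∃ d' d'', d' * d'' = 1 ∧
      (PadicInt.toZModPow 3 ((if k then 2 else 1) * a) = d' ∨
       PadicInt.toZModPow 3 ((if k then 2 else 1) * a) = 2 * d') := by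
    intro a k ha
    obtain ⟨b, hb⟩ := hu a ha
    refine ⟨_, b, hb, ?_⟩
    have e2 : PadicInt.toZModPow (p := 2) 3 2 = 2 := map_ofNat _ 2
    cases k <;> simp [e2]
  have hcast : ∀ (k : Bool) (d : ℤ_[2]), (if k then (2 : ℚ_[2]) else 1) * d =
      (((if k then 2 else 1) * d : ℤ_[2]) : ℚ_[2]) := by
    intro k d
    have e2 : ((2 : ℤ_[2]) : ℚ_[2]) = 2 := rfl
    cases k <;> simp [e2]
  rw [hcast, hcast]
  obtain ⟨x, y, z, v, w, h1, h2⟩ := mod8 _ _ _ _ _ (hu a ha) (hu b hb) (hu c hc) (hu2 d k hd)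
    (hu2 e l he)
  generalize (if k then 2 else 1) * d = d at *
  generalize (if l then 2 else 1) * e = e at *
  have fin : ∀ X Y Z V W : ℤ_[2], a * X ^ 2 + b * Y ^ 2 + c * Z ^ 2 + d * V ^ 2 + e * W ^ 2 = 0 →
      (X ≠ 0 ∨ Y ≠ 0 ∨ Z ≠ 0 ∨ V ≠ 0 ∨ W ≠ 0) → Iso5 ℚ_[2] ![(a : ℚ_[2]), b, c, d, e] := by
    intro X Y Z V W h hne
    refine ⟨![(X : ℚ_[2]), Y, Z, V, W], ?_, ?_⟩
    · intro h0
      have h0' := fun i => congrFun h0 i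
      simp [Fin.forall_fin_succ] at h0'
      tauto
    · have := congrArg (fun x : ℤ_[2] => (x : ℚ_[2])) h
      simpa [Fin.sum_univ_five] using this
  rcases h1 with rfl | rfl | rfl
  · obtain ⟨X, hX0, hX⟩ := lift8 a (b * y ^ 2 + c * z ^ 2 + d * v ^ 2 + e * w ^ 2) ha (by
      simp only [map_add, map_mul, map_pow, map_natCast]
      rw [← h2]; push_cast; ring)
    exact fin X y z v w (by linear_combination hX) (by tauto)
  · obtain ⟨X, hX0, hX⟩ := lift8 b (a * x ^ 2 + c * z ^ 2 + d * v ^ 2 + e * w ^ 2) hb (by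
      simp only [map_add, map_mul, map_pow, map_natCast]
      rw [← h2]; push_cast; ring)
    exact fin x X z v w (by linear_combination hX) (by tauto)
  · obtain ⟨X, hX0, hX⟩ := lift8 c (a * x ^ 2 + b * y ^ 2 + d * v ^ 2 + e * w ^ 2) hc (by
      simp only [map_add, map_mul, map_pow, map_natCast]
      rw [← h2]; push_cast; ring)
    exact fin x y X v w (by linear_combination hX) (by tauto)

theorem local5 {p : ℕ} [Fact p.Prime] (c : Fin 5 → ℚ_[p]) (hc : ∀ i, c i ≠ 0) :
    Iso5 ℚ_[p] c := by
  have hp : (p : ℚ_[p]) ≠ 0 := by exact_mod_cast (Fact.out : p.Prime).ne_zero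
  choose e u s hu hs h using fun i => nf (c i) (hc i)
  obtain ⟨σ, h1, h2⟩ := pigeon e
  apply Iso5.perm c σ
  by_cases hp2 : p = 2
  · subst hp2
    cases he : e (σ 0)
    · have := two5 (u (σ 0)) (u (σ 1)) (u (σ 2)) (u (σ 3)) (u (σ 4)) (e (σ 3)) (e (σ 4))
        (hu _) (hu _) (hu _) (hu _) (hu _)
      refine Iso5.scale _ _ (fun i => s (σ i)) 1 (fun i => hs _) one_ne_zero ?_ this
      intro i
      rw [Function.comp, one_mul, h]
      rw [he] at h1
      rw [← h1] at h2
      fin_cases i <;> simp [he, ← h1, ← h2]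
    · have := two5 (u (σ 0)) (u (σ 1)) (u (σ 2)) (u (σ 3)) (u (σ 4)) (!e (σ 3)) (!e (σ 4))
        (hu _) (hu _) (hu _) (hu _) (hu _)
      have h2' : (2 : ℚ_[2]) ≠ 0 := two_ne_zero
      refine Iso5.scale _ _ (fun i => s (σ i) * (if e (σ i) then 2⁻¹ else 1)) 2 (fun i => ?_)
        h2' ?_ this
      · apply mul_ne_zero (hs _)
        split_ifs
        · exact inv_ne_zero h2'
        · exact one_ne_zero
      intro i
      rw [Function.comp, mul_pow, ← mul_assoc, mul_assoc 2, h]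
      rw [he] at h1
      rw [← h1] at h2
      have key : 2 * ((if e (σ i) = true then ((2 : ℕ) : ℚ_[2]) else 1) * (u (σ i) : ℚ_[2])) *
          (if e (σ i) = true then 2⁻¹ else 1) ^ 2 = (if (!e (σ i)) then 2 else 1) * u (σ i) := by
        cases e (σ i)
        · simp
        · simp; field_simp
      rw [key]
      fin_cases i <;> simp [he, ← h1, ← h2]
  · obtain ⟨x, y, z, hne, hx⟩ := unit3 hp2 _ _ _ (hu (σ 0)) (hu (σ 1)) (hu (σ 2))
    refine ⟨![s (σ 0) * x, s (σ 1) * y, s (σ 2) * z, 0, 0], ?_, ?_⟩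
    · intro h0
      have h0' := fun i => congrFun h0 i
      simp [Fin.forall_fin_succ, hs] at h0'
      tauto
    · simp only [Fin.sum_univ_five]
      simp
      have a0 := h (σ 0)
      have a1 := h (σ 1)
      have a2 := h (σ 2)
      rw [← h2, ← h1] at a2
      rw [← h1] at a1
      linear_combination x ^ 2 * a0 + y ^ 2 * a1 + z ^ 2 * a2 + (if e (σ 0) then (p : ℚ_[p]) else 1) * hx


theorem split5 {K : Type} [Field K] [CharZero K] (a1 a2 a3 a4 b : K) (h1 : a1 ≠ 0) (h2 : a2 ≠ 0)
    (hb : b ≠ 0) (x : Fin 5 → K) (hx : x ≠ 0)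
    (h : a1 * x 0 ^ 2 + a2 * x 1 ^ 2 + a3 * x 2 ^ 2 + a4 * x 3 ^ 2 = b * x 4 ^ 2) :
    ∃ u v : K, a1 * u ^ 2 + a2 * v ^ 2 ≠ 0 ∧ I4 K a3 a4 (a1 * u ^ 2 + a2 * v ^ 2) b := by
  by_cases h0 : a1 * x 0 ^ 2 + a2 * x 1 ^ 2 = 0
  · by_cases hxy : x 0 ≠ 0 ∨ x 1 ≠ 0
    · obtain ⟨u, v, huv⟩ := univ2 a1 a2 _ _ h1 h2 hxy h0 b
      exact ⟨u, v, by rwa [huv], 0, 0, 1, 1, by simp, by rw [huv]; ring⟩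
    · push Not at hxy
      refine ⟨1, 0, by simpa using h1, x 2, x 3, 0, x 4, ?_, by linear_combination h - h0⟩
      by_contra hcon
      push Not at hcon
      apply hx
      ext i
      fin_cases i
      · exact hxy.1
      · exact hxy.2
      · exact hcon.1
      · exact hcon.2.1
      · exact hcon.2.2.2
  · exact ⟨x 0, x 1, h0, x 2, x 3, 1, x 4, by simp, by linear_combination h⟩

theorem five (a1 a2 a3 a4 b : ℕ) (h1 : 0 < a1) (h2 : 0 < a2) (h3 : 0 < a3) (h4 : 0 < a4)
    (hb : 0 < b) : ∃ x1 x2 x3 x4 x5 : ℚ, (x1 ≠ 0 ∨ x2 ≠ 0 ∨ x3 ≠ 0 ∨ x4 ≠ 0 ∨ x5 ≠ 0) ∧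
      a1 * x1 ^ 2 + a2 * x2 ^ 2 + a3 * x3 ^ 2 + a4 * x4 ^ 2 = b * x5 ^ 2 := by
  obtain ⟨M, hM⟩ : ∃ M, M = 2 * a3 * a4 * b := ⟨_, rfl⟩
  have hM0 : M ≠ 0 := by rw [hM]; positivity
  have key : ∀ (p : ℕ) [Fact p.Prime], ∃ (X Y : ℤ_[p]) (k : ℕ),
      ¬ (p : ℤ_[p]) ^ (k + 1) ∣ a1 * X ^ 2 + a2 * Y ^ 2 ∧
      I4 ℚ_[p] a3 a4 ((a1 * X ^ 2 + a2 * Y ^ 2 : ℤ_[p]) : ℚ_[p]) b := by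
    intro p _
    obtain ⟨x, hx, hsum⟩ := local5 (p := p) ![(a1 : ℚ_[p]), a2, a3, a4, -b] (by
      simp [Fin.forall_fin_succ]; omega)
    rw [Fin.sum_univ_five] at hsum
    simp at hsum
    obtain ⟨u, v, ht, hI⟩ := split5 (a1 : ℚ_[p]) a2 a3 a4 b (by exact_mod_cast h1.ne')
      (by exact_mod_cast h2.ne') (by exact_mod_cast hb.ne') x hx (by linear_combination hsum)
    obtain ⟨e, X, Y, -, -, he, hX, hY, -, -⟩ := exists_scale u v 0 0
    have h0 : (((a1 : ℤ_[p]) * X ^ 2 + (a2 : ℤ_[p]) * Y ^ 2 : ℤ_[p]) : ℚ_[p]) =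
        e ^ 2 * (a1 * u ^ 2 + a2 * v ^ 2) := by
      push_cast
      rw [hX, hY]; ring
    obtain ⟨k, hk⟩ := not_pow_dvd ((a1 : ℤ_[p]) * X ^ 2 + (a2 : ℤ_[p]) * Y ^ 2) (by
      intro h00
      rw [h00] at h0
      have : e ^ 2 * (a1 * u ^ 2 + a2 * v ^ 2) = 0 := by rw [← h0]; rfl
      rcases mul_eq_zero.1 this with h | h
      · exact he (by simpa using h)
      · exact ht h)
    refine ⟨X, Y, k, hk, ?_⟩
    rw [h0]
    obtain ⟨x, y, w, z, hne, h⟩ := hI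
    refine ⟨x, y, w / e, z, by simpa [he] using hne, ?_⟩
    rw [← h]
    field_simp
  choose X Y k hk hI using key
  obtain ⟨k0, hk0⟩ := sup_bound M hM0 (fun p => k p)
  obtain ⟨x, hx0, hx⟩ := approx M hM0 (k0 + 4) (fun p => X p) 0
  obtain ⟨y, -, hy⟩ := approx M hM0 (k0 + 4) (fun p => Y p) 0
  have ht : 0 < (a1 : ℤ) * x ^ 2 + a2 * y ^ 2 := by positivity
  obtain ⟨t, e0⟩ := Int.eq_ofNat_of_zero_le ht.le
  have ht0 : 0 < t := by rw [e0] at ht; exact_mod_cast ht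
  have hloc : ∀ (p : ℕ) [Fact p.Prime], I4 ℚ_[p] a3 a4 t b := by
    intro p hpf
    have hp : p.Prime := hpf.1
    by_cases hpM : p ∣ M
    · have hd := dvd_quad _ (a1 : ℤ_[p]) a2 _ _ _ _ (hx p hpM) (hy p hpM)
      have e : (a1 : ℤ_[p]) * x ^ 2 + a2 * y ^ 2 = t := by
        exact_mod_cast congrArg (Int.cast : ℤ → ℤ_[p]) e0
      rw [e] at hd
      have hkp := hk p
      have hIp := hI p
      have hkk := hk0 p hpM
      generalize (a1 : ℤ_[p]) * X p ^ 2 + (a2 : ℤ_[p]) * Y p ^ 2 = s at *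
      have n1 : ‖(t : ℤ_[p]) - s‖ ≤ (p : ℝ) ^ (-((k p + 4 : ℕ) : ℤ)) := by
        rw [PadicInt.norm_le_pow_iff_mem_span_pow, Ideal.mem_span_singleton]
        exact (pow_dvd_pow _ (by omega)).trans hd
      have n2 : (p : ℝ) ^ (-((k p + 1 : ℕ) : ℤ)) < ‖s‖ := by
        rw [← not_le, PadicInt.norm_le_pow_iff_mem_span_pow, Ideal.mem_span_singleton]
        exact hkp
      have n3 : (p : ℝ) ^ (-((3 : ℕ) : ℤ)) < ‖((4 : ℤ) : ℤ_[p])‖ := by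
        rw [← not_le, PadicInt.norm_le_pow_iff_mem_span_pow, Ideal.mem_span_singleton, padic_int_dvd]
        intro hd
        have := Int.le_of_dvd (by norm_num) hd
        have h8 : 2 ^ 3 ≤ p ^ 3 := Nat.pow_le_pow_left hp.two_le 3
        have : p ^ 3 ≤ 4 := by exact_mod_cast this
        omega
      have hpr : (0 : ℝ) < p := by exact_mod_cast hp.pos
      rw [PadicInt.norm_def] at n1 n2 n3
      push_cast at n1 n2 n3
      obtain ⟨c, hc, hts⟩ := close_sq (t : ℚ_[p]) s (by
          rw [← norm_pos_iff]; exact lt_trans (zpow_pos hpr _) n2) (by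
        refine lt_of_le_of_lt n1 ?_
        have : (p : ℝ) ^ (-((k p : ℤ) + 4)) = (p : ℝ) ^ (-((k p : ℤ) + 1)) * (p : ℝ) ^ (-3 : ℤ) := by
          rw [← zpow_add₀ hpr.ne']; ring_nf
        rw [this]
        exact mul_lt_mul'' n2 n3 (zpow_pos hpr _).le (zpow_pos hpr _).le)
      obtain ⟨x, y, w, z, hne, h⟩ := hIp
      refine ⟨x, y, w / c, z, by simpa [hc] using hne, ?_⟩
      rw [← h, hts]
      field_simp
    · have hp2 : p ≠ 2 := by
        rintro rfl; exact hpM ⟨a3 * a4 * b, by rw [hM]; ring⟩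
      have int1 : ∀ k : ℕ, k ∣ M → ‖((k : ℕ) : ℤ_[p])‖ = 1 := by
        intro k hk
        rw [← toZMod_ne, map_natCast, Ne, ZMod.natCast_eq_zero_iff]
        exact fun h => hpM (h.trans hk)
      obtain ⟨x, y, z, hne, h⟩ := unit3 hp2 (a3 : ℤ_[p]) a4 (-b)
        (int1 _ ⟨2 * a4 * b, by rw [hM]; ring⟩) (int1 _ ⟨2 * a3 * b, by rw [hM]; ring⟩)
        (by rw [norm_neg]; exact int1 _ ⟨2 * a3 * a4, by rw [hM]; ring⟩)
      push_cast at h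
      exact ⟨x, y, 0, z, by tauto, by linear_combination h⟩
  obtain ⟨u, v, w, z, hne, h⟩ := quat a3 a4 b t h3 h4 hb ht0 hloc
  have e0' : (a1 : ℚ) * x ^ 2 + a2 * y ^ 2 = t := by
    exact_mod_cast congrArg (Int.cast : ℤ → ℚ) e0
  refine ⟨x * w, y * w, u, v, z, ?_, by linear_combination w ^ 2 * e0' + h⟩
  have : (x : ℚ) ≠ 0 := by exact_mod_cast hx0.ne'
  have : w ≠ 0 → x * w ≠ 0 := fun hw => mul_ne_zero this hw
  tauto

theorem ratnat (q : ℚ) (hq : 0 < q) : ∃ (A : ℕ) (d : ℚ), 0 < A ∧ d ≠ 0 ∧ (A : ℚ) = q * d ^ 2 := by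
  have hn : 0 < q.num := Rat.num_pos.2 hq
  obtain ⟨m, hm⟩ := Int.eq_ofNat_of_zero_le hn.le
  have hd : (q.den : ℚ) ≠ 0 := by exact_mod_cast q.den_ne_zero
  have hm0 : 0 < m := by rw [hm] at hn; exact_mod_cast hn
  refine ⟨m * q.den, q.den, Nat.mul_pos hm0 q.den_pos, hd, ?_⟩
  have h1 : q = (m : ℚ) / q.den := by
    conv_lhs => rw [← Rat.num_div_den q, hm]
    simp
  push_cast
  have : q * q.den = m := by rw [Rat.mul_den_eq_num, hm]; simp
  linear_combination -(q.den : ℚ) * this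

theorem rep4 (a1 a2 a3 a4 b : ℚ) (h1 : 0 < a1) (h2 : 0 < a2) (h3 : 0 < a3) (h4 : 0 < a4)
    (hb : 0 < b) : ∃ x1 x2 x3 x4 : ℚ,
      a1 * x1 ^ 2 + a2 * x2 ^ 2 + a3 * x3 ^ 2 + a4 * x4 ^ 2 = b := by
  obtain ⟨A1, d1, p1, n1, e1⟩ := ratnat a1 h1
  obtain ⟨A2, d2, p2, n2, e2⟩ := ratnat a2 h2
  obtain ⟨A3, d3, p3, n3, e3⟩ := ratnat a3 h3
  obtain ⟨A4, d4, p4, n4, e4⟩ := ratnat a4 h4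
  obtain ⟨B, d5, p5, n5, e5⟩ := ratnat b hb
  obtain ⟨x1, x2, x3, x4, x5, hne, h⟩ := five A1 A2 A3 A4 B p1 p2 p3 p4 p5
  have hx5 : x5 ≠ 0 := by
    rintro rfl
    have q1 : 0 ≤ (A1 : ℚ) * x1 ^ 2 := by positivity
    have q2 : 0 ≤ (A2 : ℚ) * x2 ^ 2 := by positivity
    have q3 : 0 ≤ (A3 : ℚ) * x3 ^ 2 := by positivity
    have q4 : 0 ≤ (A4 : ℚ) * x4 ^ 2 := by positivity
    have z1 : (A1 : ℚ) * x1 ^ 2 = 0 := by linarith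
    have z2 : (A2 : ℚ) * x2 ^ 2 = 0 := by linarith
    have z3 : (A3 : ℚ) * x3 ^ 2 = 0 := by linarith
    have z4 : (A4 : ℚ) * x4 ^ 2 = 0 := by linarith
    simp [p1.ne', p2.ne', p3.ne', p4.ne'] at z1 z2 z3 z4
    tauto
  refine ⟨d1 * x1 / (d5 * x5), d2 * x2 / (d5 * x5), d3 * x3 / (d5 * x5), d4 * x4 / (d5 * x5), ?_⟩
  rw [e1, e2, e3, e4, e5] at h
  have hne : (d5 * x5) ^ 2 ≠ 0 := pow_ne_zero _ (mul_ne_zero n5 hx5)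
  simp only [div_pow]
  field_simp
  linear_combination h

end Paper

namespace Paper

open Matrix

theorem qeval_posdef {n : ℕ} (F : Matrix (Fin n) (Fin n) ℚ)
    (hpos : ∀ v : Fin n → ℝ, v ≠ 0 → 0 < qeval (F.map (Rat.cast : ℚ → ℝ)) v)
    (v : Fin n → ℚ) (hv : v ≠ 0) : 0 < qeval F v := by
  have h := hpos (fun i => (v i : ℝ)) (by
    intro h0
    apply hv
    ext i
    have := congrFun h0 i
    simpa using this)
  have e : qeval (F.map (Rat.cast : ℚ → ℝ)) (fun i => (v i : ℝ)) = ((qeval F v : ℚ) : ℝ) := by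
    simp [qeval, dotProduct, Matrix.mulVec]
  rw [e] at h
  exact_mod_cast h

theorem toQF_apply {n : ℕ} (F : Matrix (Fin n) (Fin n) ℚ) (v : Fin n → ℚ) :
    F.toQuadraticForm' v = qeval F v := by
  simp [Matrix.toQuadraticForm', qeval, Matrix.toLinearMap₂'_apply']

/-- Lemma (a). A nonsingular positive definite rational quadratic form in
`n ≥ 4` variables represents every positive rational number. -/
theorem posdef_represents_positive (n : ℕ) (hn : 4 ≤ n)
    (F : Matrix (Fin n) (Fin n) ℚ) (hFsymm : F.IsSymm) (hFns : F.det ≠ 0)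
    (hpos : ∀ v : Fin n → ℝ, v ≠ 0 → 0 < qeval (F.map (Rat.cast : ℚ → ℝ)) v)
    (b : ℚ) (hb : 0 < b) :
    ∃ v : Fin n → ℚ, v ≠ 0 ∧ qeval F v = b := by
  obtain ⟨w, ⟨e⟩⟩ := QuadraticForm.equivalent_weightedSumSquares (F.toQuadraticForm')
  have hN : Module.finrank ℚ (Fin n → ℚ) = n := by simp
  generalize Module.finrank ℚ (Fin n → ℚ) = N at *
  have he : ∀ v, qeval F (e.symm v) = ∑ i, w i * (v i * v i) := by
    intro v
    rw [← toQF_apply, QuadraticMap.IsometryEquiv.map_app, QuadraticMap.weightedSumSquares_apply]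
    simp
  have hw : ∀ i, 0 < w i := by
    intro i
    have h1 := qeval_posdef F hpos (e.symm (Pi.single i 1)) (by
      intro h0
      have := congrArg e h0
      rw [QuadraticMap.IsometryEquiv.apply_symm_apply] at this
      have h2 := congrFun (this.trans (map_zero e.toLinearEquiv)) i
      simp at h2)
    rw [he] at h1
    simpa [Pi.single_apply] using h1
  rw [← hN] at hn
  obtain ⟨m, rfl⟩ := Nat.exists_eq_add_of_le hn
  obtain ⟨x1, x2, x3, x4, hx⟩ := rep4 (w (Fin.castAdd m 0)) (w (Fin.castAdd m 1))
    (w (Fin.castAdd m 2)) (w (Fin.castAdd m 3)) b (hw _) (hw _) (hw _) (hw _) hb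
  have hval : qeval F (e.symm (Fin.append ![x1, x2, x3, x4] (0 : Fin m → ℚ))) = b := by
    rw [he, Fin.sum_univ_add]
    simp only [Fin.append_left, Fin.append_right]
    simp only [Fin.sum_univ_four]
    simp
    linear_combination hx
  refine ⟨_, ?_, hval⟩
  intro h0
  rw [h0] at hval
  simp [qeval] at hval
  exact hb.ne hval

end Paper
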